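/- arXiv:1501.06214 — 3 statements merged into one kernel-verified Lean document; each statement's English description precedes it below -/
import Mathlib

section
/- Let n ≥ 2 and let i ∈ {1, …, n−1}. For every c > 0 and every α > 1/2 there exist convex bodies K, L in ℝⁿ, both contained in the closed unit ball, with K ≠ L, such that d_bL(Ψ_i(K,·), Ψ_i(L,·)) > c · d_H(K, L)^α. In other words, the Hölder exponent 1/2 in the estimate d_bL(Ψ_i(K,·), Ψ_i(L,·)) ≤ C(R) d_H(K,L)^{1/2} cannot be replaced by any larger exponent. -/
open MeasureTheory Metric Set Real Pointwise RealInnerProductSpace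

noncomputable section

/-- Euclidean n-space. -/
abbrev En (n : ℕ) : Type := EuclideanSpace ℝ (Fin n)

/-- A convex body: a nonempty compact convex set. -/
def IsConvexBody {n : ℕ} (K : Set (En n)) : Prop :=
  K.Nonempty ∧ IsCompact K ∧ Convex ℝ K

/-- The parallel body `K_ρ = K + ρ Bⁿ`. -/
def pbody {n : ℕ} (K : Set (En n)) (ρ : ℝ) : Set (En n) :=
  K + Metric.closedBall (0 : En n) ρ

/-- `K^ρ = K_ρ \ K`. -/
def shell {n : ℕ} (K : Set (En n)) (ρ : ℝ) : Set (En n) :=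
  pbody K ρ \ K

/-- `p` is the metric projection onto `K`. -/
def IsMetricProj {n : ℕ} (K : Set (En n)) (p : En n → En n) : Prop :=
  ∀ x, p x ∈ K ∧ dist x (p x) = Metric.infDist x K

/-- `u_K(x) = (x - p_K(x)) / dist(x, K)`. -/
def uvec {n : ℕ} (K : Set (En n)) (p : En n → En n) (x : En n) : En n :=
  (Metric.infDist x K)⁻¹ • (x - p x)

/-- The local parallel volume measure `μ_{K,ρ}`. -/
def parMeas {n : ℕ} (K : Set (En n)) (p : En n → En n) (ρ : ℝ) :
    Measure (En n × En n) :=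
  Measure.map (fun x => (p x, uvec K p x)) (volume.restrict (shell K ρ))

/-- A test function for the bounded Lipschitz distance on `ℝⁿ × ℝⁿ`:
Lipschitz constant at most 1 w.r.t. the Euclidean metric on the product, and `sup |f| ≤ 1`. -/
def IsBLFun {n : ℕ} (f : En n × En n → ℝ) : Prop :=
  (∀ a b : En n × En n, |f a - f b| ≤ Real.sqrt (‖a.1 - b.1‖ ^ 2 + ‖a.2 - b.2‖ ^ 2)) ∧
  ∀ a, |f a| ≤ 1

/-- `κ_m`, the volume of the `m`-dimensional unit ball. -/
def kappa (m : ℕ) : ℝ :=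
  (volume (Metric.closedBall (0 : EuclideanSpace ℝ (Fin m)) 1)).toReal

/-- The matrix of the linear system from the local Steiner formula at `ρ_j = j/n`. -/
def steinerMatrix (n : ℕ) : Matrix (Fin n) (Fin n) ℝ :=
  Matrix.of fun j i => ((j.1 + 1 : ℝ) / n) ^ (n - i.1) * kappa (n - i.1)

/-- The coefficients `a_{ij}` expressing the support measures via local parallel volumes. -/
def steinerCoeff (n : ℕ) : Matrix (Fin n) (Fin n) ℝ := (steinerMatrix n)⁻¹

/-- A test function for the bounded Lipschitz distance on the sphere `S^{n-1}`. -/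
def IsSphereBLFun {n : ℕ} (g : En n → ℝ) : Prop :=
  (∀ a b : En n, ‖a‖ = 1 → ‖b‖ = 1 → |g a - g b| ≤ ‖a - b‖) ∧
  ∀ a : En n, ‖a‖ = 1 → |g a| ≤ 1



structure SF (h h1 h2 : ℝ → ℝ) : Prop where
  d1 : ∀ θ, HasDerivAt h (h1 θ) θ
  d2 : ∀ θ, HasDerivAt h1 (h2 θ) θ
  per : ∀ θ, h (θ + 2 * π) = h θ
  pos : ∀ θ, 0 < h θ + h2 θ
  nn : ∀ θ, 0 ≤ h θ

def AS (h : ℝ → ℝ) : Set ℂ := {y | ∀ θ : ℝ, y.re * cos θ + y.im * sin θ ≤ h θ}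

def gam (h h1 : ℝ → ℝ) (θ : ℝ) : ℂ := ⟨h θ * cos θ - h1 θ * sin θ, h θ * sin θ + h1 θ * cos θ⟩

def IsPr (A : Set ℂ) (p : ℂ → ℂ) : Prop :=
  (∀ y, p y ∈ A) ∧ ∀ y, ∀ a ∈ A,
    (y.re - (p y).re) * (a.re - (p y).re) + (y.im - (p y).im) * (a.im - (p y).im) ≤ 0

lemma exists_isPr {A : Set ℂ} (hc : IsCompact A) (hA : Convex ℝ A) (hne : A.Nonempty) :
    ∃ p, IsPr A p := by
  have : ∀ y : ℂ, ∃ q ∈ A, ∀ a ∈ A,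
    (y.re - q.re) * (a.re - q.re) + (y.im - q.im) * (a.im - q.im) ≤ 0 := by
    intro y
    obtain ⟨q, hq, hd⟩ := hc.exists_infDist_eq_dist hne y
    refine ⟨q, hq, fun a ha => ?_⟩
    have h1 := (norm_eq_iInf_iff_real_inner_le_zero hA (u := y) hq).1 (by
      rw [Metric.infDist_eq_iInf] at hd
      simpa [dist_eq_norm] using hd.symm) a ha
    rw [Complex.inner] at h1
    simp only [Complex.mul_re, Complex.conj_re, Complex.conj_im, Complex.sub_re, Complex.sub_im] at h1
    linarith
  choose p h1 h2 using this
  exact ⟨p, h1, h2⟩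

lemma IsPr.uniq {A : Set ℂ} {p : ℂ → ℂ} (hp : IsPr A p) {y q : ℂ} (hq : q ∈ A)
    (h : ∀ a ∈ A, (y.re - q.re) * (a.re - q.re) + (y.im - q.im) * (a.im - q.im) ≤ 0) :
    p y = q := by
  have h1 := h _ (hp.1 y)
  have h2 := hp.2 y q hq
  have : (q.re - (p y).re)^2 + (q.im - (p y).im)^2 ≤ 0 := by nlinarith
  apply Complex.ext
  · nlinarith [sq_nonneg (q.re - (p y).re), sq_nonneg (q.im - (p y).im)]
  · nlinarith [sq_nonneg (q.re - (p y).re), sq_nonneg (q.im - (p y).im)]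

lemma IsPr.self {A : Set ℂ} {p : ℂ → ℂ} (hp : IsPr A p) {y : ℂ} (hy : y ∈ A) : p y = y :=
  hp.uniq hy (by simp)

lemma nsq (y : ℂ) : ‖y‖ ^ 2 = y.re ^ 2 + y.im ^ 2 := by
  rw [Complex.sq_norm, Complex.normSq_apply]; ring

lemma IsPr.continuous {A : Set ℂ} {p : ℂ → ℂ} (hp : IsPr A p) : Continuous p := by
  apply LipschitzWith.continuous (K := 1)
  apply LipschitzWith.of_dist_le_mul
  intro x y
  have h1 := hp.2 x _ (hp.1 y)
  have h2 := hp.2 y _ (hp.1 x)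
  rw [dist_eq_norm, dist_eq_norm, NNReal.coe_one, one_mul]
  apply le_of_sq_le_sq _ (norm_nonneg _)
  rw [nsq, nsq]
  simp only [Complex.sub_re, Complex.sub_im]
  nlinarith [sq_nonneg (x.re - y.re - ((p x).re - (p y).re)), sq_nonneg (x.im - y.im - ((p x).im - (p y).im))]

lemma IsPr.min {A : Set ℂ} {p : ℂ → ℂ} (hp : IsPr A p) (y : ℂ) {a : ℂ} (ha : a ∈ A) :
    ‖y - p y‖ ^ 2 ≤ ‖y - a‖ ^ 2 := by
  have h1 := hp.2 y _ ha
  rw [nsq, nsq]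
  simp only [Complex.sub_re, Complex.sub_im]
  nlinarith [sq_nonneg (a.re - (p y).re), sq_nonneg (a.im - (p y).im)]

lemma AS_convex (h : ℝ → ℝ) : Convex ℝ (AS h) := by
  intro x hx y hy a b ha hb hab θ
  have h1 := hx θ
  have h2 := hy θ
  have : h θ = a * h θ + b * h θ := by rw [← add_mul, hab, one_mul]
  simp
  rw [this]
  nlinarith [mul_le_mul_of_nonneg_left h1 ha, mul_le_mul_of_nonneg_left h2 hb]

lemma AS_closed (h : ℝ → ℝ) : IsClosed (AS h) := by
  rw [show AS h = ⋂ θ : ℝ, {y : ℂ | y.re * cos θ + y.im * sin θ ≤ h θ} by ext; simp [AS]]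
  refine isClosed_iInter fun θ => isClosed_le ?_ continuous_const
  fun_prop

lemma AS_norm {h : ℝ → ℝ} {R : ℝ} (hR : ∀ θ, h θ ≤ R) {y : ℂ} (hy : y ∈ AS h) : ‖y‖ ≤ R := by
  have h1 := hy y.arg
  have h2 := hR y.arg
  by_cases h0 : y = 0
  · subst h0; simp at h1; simpa using h1.trans (by simpa using h2)
  have hn : 0 < ‖y‖ := norm_pos_iff.2 h0
  rw [Complex.cos_arg h0, Complex.sin_arg] at h1
  have h3 := nsq y
  have : y.re * (y.re / ‖y‖) + y.im * (y.im / ‖y‖) = ‖y‖ := by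
    field_simp; linarith
  linarith

lemma AS_compact {h : ℝ → ℝ} {R : ℝ} (hR : ∀ θ, h θ ≤ R) : IsCompact (AS h) := by
  refine Metric.isCompact_of_isClosed_isBounded (AS_closed h) ?_
  refine (Metric.isBounded_closedBall (x := (0:ℂ)) (r := R)).subset fun y hy => ?_
  simpa using AS_norm hR hy

lemma SF.gam_mem {h h1 h2 : ℝ → ℝ} (H : SF h h1 h2) (θ : ℝ) : gam h h1 θ ∈ AS h := by
  intro φ
  have hper : Function.Periodic (fun φ => h φ - (h θ * cos (φ - θ) + h1 θ * sin (φ - θ))) (2 * π) := by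
    intro x
    simp only [H.per]
    rw [show x + 2 * π - θ = x - θ + 2 * π by ring, cos_add_two_pi, sin_add_two_pi]
  obtain ⟨ψ, hψ, he⟩ := hper.exists_mem_Ico Real.two_pi_pos φ (θ - π)
  have hW : ∀ s, HasDerivAt (fun s => h1 s * sin (ψ - s) + h s * cos (ψ - s))
      ((h s + h2 s) * sin (ψ - s)) s := by
    intro s
    have e1 : HasDerivAt (fun s => ψ - s) (-1) s := by
      simpa using (hasDerivAt_id s).const_sub ψ
    have := ((H.d2 s).mul e1.sin).add ((H.d1 s).mul e1.cos)
    refine this.congr_deriv ?_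
    ring
  have hD : Differentiable ℝ (fun s => h1 s * sin (ψ - s) + h s * cos (ψ - s)) :=
    fun s => (hW s).differentiableAt
  have key : h1 θ * sin (ψ - θ) + h θ * cos (ψ - θ) ≤ h ψ := by
    rcases le_total θ ψ with hl | hl
    · have := monotoneOn_of_deriv_nonneg (convex_Icc θ ψ) hD.continuous.continuousOn
        hD.differentiableOn (by
          intro s hs
          rw [interior_Icc] at hs
          rw [(hW s).deriv]
          exact mul_nonneg (H.pos s).le (sin_nonneg_of_nonneg_of_le_pi (by linarith [hs.2]) (by linarith [hs.1, hψ.2])))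
        (left_mem_Icc.2 hl) (right_mem_Icc.2 hl) hl
      simpa using this
    · have := antitoneOn_of_deriv_nonpos (convex_Icc ψ θ) hD.continuous.continuousOn
        hD.differentiableOn (by
          intro s hs
          rw [interior_Icc] at hs
          rw [(hW s).deriv]
          exact mul_nonpos_of_nonneg_of_nonpos (H.pos s).le (sin_nonpos_of_nonpos_of_neg_pi_le (by linarith [hs.1]) (by linarith [hs.2, hψ.1])))
        (left_mem_Icc.2 hl) (right_mem_Icc.2 hl) hl
      simpa using this
  have e2 : (gam h h1 θ).re * cos φ + (gam h h1 θ).im * sin φ = h θ * cos (φ - θ) + h1 θ * sin (φ - θ) := by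
    simp only [gam, cos_sub, sin_sub]; ring
  rw [e2]
  linarith

def Phi (h h1 : ℝ → ℝ) (θ t : ℝ) : ℂ := gam h h1 θ + ⟨t * cos θ, t * sin θ⟩

lemma SF.pr_Phi {h h1 h2 : ℝ → ℝ} (H : SF h h1 h2) {p : ℂ → ℂ} (hp : IsPr (AS h) p) (θ : ℝ) {t : ℝ}
    (ht : 0 ≤ t) : p (Phi h h1 θ t) = gam h h1 θ := by
  refine hp.uniq (H.gam_mem θ) fun a ha => ?_
  have h3 := ha θ
  simp only [Phi, gam, Complex.add_re, Complex.add_im]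
  have : t * ((a.re * cos θ + a.im * sin θ) - h θ) ≤ 0 := mul_nonpos_of_nonneg_of_nonpos ht (by linarith)
  have e := sin_sq_add_cos_sq θ
  have : t * ((a.re * cos θ + a.im * sin θ) - h θ * (sin θ ^ 2 + cos θ ^ 2)) ≤ 0 := by
    rw [e]; linarith
  linarith

lemma Phi_sub {h h1 : ℝ → ℝ} (θ t : ℝ) : Phi h h1 θ t - gam h h1 θ = ⟨t * cos θ, t * sin θ⟩ := by
  simp [Phi]

lemma norm_pol (θ : ℝ) {t : ℝ} (ht : 0 ≤ t) : ‖(⟨t * cos θ, t * sin θ⟩ : ℂ)‖ = t := by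
  have : ‖(⟨t * cos θ, t * sin θ⟩ : ℂ)‖ ^ 2 = t ^ 2 := by
    rw [nsq]; simp only
    have e := sin_sq_add_cos_sq θ
    linear_combination t ^ 2 * e
  exact (sq_eq_sq₀ (norm_nonneg _) ht).1 this

lemma Phi_inner {h h1 : ℝ → ℝ} (θ t : ℝ) :
    (Phi h h1 θ t).re * cos θ + (Phi h h1 θ t).im * sin θ = h θ + t := by
  have e := sin_sq_add_cos_sq θ
  simp only [Phi, gam, Complex.add_re, Complex.add_im]
  linear_combination (h θ + t) * e

lemma SF.surj {h h1 h2 : ℝ → ℝ} (H : SF h h1 h2) {p : ℂ → ℂ} (hp : IsPr (AS h) p) {y : ℂ}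
    (hy : y ∉ AS h) : ∃ θ ∈ Ioc (-π) π, ∃ t ∈ Ioi (0 : ℝ), Phi h h1 θ t = y := by
  set w := y - p y with hw
  have hw0 : w ≠ 0 := by
    intro h0
    have : y = p y := sub_eq_zero.1 h0
    exact hy (this ▸ hp.1 y)
  have hn : 0 < ‖w‖ := norm_pos_iff.2 hw0
  have hwre : ‖w‖ * cos w.arg = w.re := Complex.norm_mul_cos_arg w
  have hwim : ‖w‖ * sin w.arg = w.im := Complex.norm_mul_sin_arg w
  refine ⟨w.arg, Complex.arg_mem_Ioc w, ‖w‖, hn, ?_⟩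
  set θ := w.arg
  have h3 := hp.2 y _ (H.gam_mem θ)
  have h4 := hp.1 y θ
  have e := sin_sq_add_cos_sq θ
  rw [← Complex.sub_re, ← Complex.sub_im, ← hw, ← hwre, ← hwim] at h3
  have h5 : h θ - ((p y).re * cos θ + (p y).im * sin θ) ≤ 0 := by
    have : ‖w‖ * (h θ - ((p y).re * cos θ + (p y).im * sin θ)) ≤ 0 := by
      simp only [gam] at h3
      have : ‖w‖ * (h θ * (sin θ ^ 2 + cos θ ^ 2) - ((p y).re * cos θ + (p y).im * sin θ)) ≤ 0 := by
        linarith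
      rwa [e, mul_one] at this
    by_contra hcon
    push Not at hcon
    linarith [mul_pos hn hcon]
  have h6 : (p y).re * cos θ + (p y).im * sin θ = h θ := le_antisymm h4 (by linarith)
  have hd : HasDerivAt (fun φ => h φ - ((p y).re * cos φ + (p y).im * sin φ))
      (h1 θ - ((p y).re * (- sin θ) + (p y).im * cos θ)) θ :=
    (H.d1 θ).sub (((hasDerivAt_cos θ).const_mul _).add ((hasDerivAt_sin θ).const_mul _))
  have hmin : IsLocalMin (fun φ => h φ - ((p y).re * cos φ + (p y).im * sin φ)) θ := by
    refine Filter.Eventually.of_forall fun φ => ?_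
    have := hp.1 y φ
    simp only
    linarith
  have h7 := hmin.hasDerivAt_eq_zero hd
  have hg : gam h h1 θ = p y := by
    apply Complex.ext
    · simp only [gam]
      linear_combination (-cos θ) * h6 - sin θ * h7 + (p y).re * e
    · simp only [gam]
      linear_combination (-sin θ) * h6 + cos θ * h7 + (p y).im * e
  rw [Phi, hg, hwre, hwim]
  change p y + w = y
  rw [hw]; ring

lemma SF.not_mem {h h1 : ℝ → ℝ} (θ : ℝ) {t : ℝ} (ht : 0 < t) : Phi h h1 θ t ∉ AS h := by
  intro hy
  have := hy θ
  rw [Phi_inner] at this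
  linarith

lemma SF.inj {h h1 h2 : ℝ → ℝ} (H : SF h h1 h2) {p : ℂ → ℂ} (hp : IsPr (AS h) p) {θ t θ' t' : ℝ}
    (hθ : θ ∈ Ioc (-π) π) (hθ' : θ' ∈ Ioc (-π) π) (ht : 0 < t) (ht' : 0 < t')
    (he : Phi h h1 θ t = Phi h h1 θ' t') : θ = θ' ∧ t = t' := by
  have e1 := H.pr_Phi hp θ ht.le
  have e2 := H.pr_Phi hp θ' ht'.le
  have e3 : gam h h1 θ = gam h h1 θ' := by rw [← e1, he, e2]
  have e4 : (⟨t * cos θ, t * sin θ⟩ : ℂ) = ⟨t' * cos θ', t' * sin θ'⟩ := by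
    rw [← Phi_sub (h := h) (h1 := h1), ← Phi_sub (h := h) (h1 := h1), he, e3]
  have e5 : t = t' := by rw [← norm_pol θ ht.le, e4, norm_pol θ' ht'.le]
  refine ⟨?_, e5⟩
  have key : ∀ s r : ℝ, 0 < r → s ∈ Ioc (-π) π → Complex.arg ⟨r * cos s, r * sin s⟩ = s := by
    intro s r hr hs
    refine Eq.trans ?_ (Complex.arg_mul_cos_add_sin_mul_I hr hs)
    congr 1
    apply Complex.ext <;> simp [← Complex.ofReal_cos, ← Complex.ofReal_sin]
  rw [← key θ t ht hθ, e4, key θ' t' ht' hθ']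

lemma SF.dist_le {h h1 h2 k : ℝ → ℝ} (H : SF h h1 h2) {p : ℂ → ℂ} (hp : IsPr (AS h) p) {δ : ℝ}
    (hδ : 0 ≤ δ) (hk : ∀ θ, k θ ≤ h θ + δ) {y : ℂ} (hy : y ∈ AS k) : ‖y - p y‖ ≤ δ := by
  by_cases hm : y ∈ AS h
  · rw [hp.self hm]; simpa
  · obtain ⟨θ, _, t, ht, rfl⟩ := H.surj hp hm
    rw [H.pr_Phi hp θ (le_of_lt ht), Phi_sub, norm_pol θ (le_of_lt ht)]
    have := hy θ
    rw [Phi_inner] at this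
    linarith [hk θ]

lemma Phi_hasFDeriv {h h1 h2 : ℝ → ℝ} (H : SF h h1 h2) (q : ℝ × ℝ) :
    HasFDerivAt (fun q : ℝ × ℝ => ((Phi h h1 q.1 q.2).re, (Phi h h1 q.1 q.2).im))
      (Matrix.toLin (.finTwoProd ℝ) (.finTwoProd ℝ)
        !![-(h q.1 + h2 q.1 + q.2) * sin q.1, cos q.1;
          (h q.1 + h2 q.1 + q.2) * cos q.1, sin q.1]).toContinuousLinearMap q := by
  rw [Matrix.toLin_finTwoProd_toContinuousLinearMap]
  have a0 := (H.d1 q.1).comp_hasFDerivAt q (hasFDerivAt_fst (𝕜 := ℝ) (E := ℝ) (F := ℝ) (p := q))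
  have a1 := (H.d2 q.1).comp_hasFDerivAt q (hasFDerivAt_fst (𝕜 := ℝ) (E := ℝ) (F := ℝ) (p := q))
  have ac := (hasDerivAt_cos q.1).comp_hasFDerivAt q (hasFDerivAt_fst (𝕜 := ℝ) (E := ℝ) (F := ℝ) (p := q))
  have as := (hasDerivAt_sin q.1).comp_hasFDerivAt q (hasFDerivAt_fst (𝕜 := ℝ) (E := ℝ) (F := ℝ) (p := q))
  have at' := hasFDerivAt_snd (𝕜 := ℝ) (E := ℝ) (F := ℝ) (p := q)
  have b1 := ((a0.mul ac).sub (a1.mul as)).add (at'.mul ac)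
  have b2 := ((a0.mul as).add (a1.mul ac)).add (at'.mul as)
  refine (b1.prodMk b2).congr_fderiv ?_
  ext <;> simp <;> ring

lemma SF.cov {h h1 h2 : ℝ → ℝ} (H : SF h h1 h2) {p : ℂ → ℂ} (hp : IsPr (AS h) p) (f : ℂ → ℝ)
    (hf : ∀ y ∈ AS h, f y = 0) :
    ∫ y, f y = ∫ q in Ioc (-π) π ×ˢ Ioi (0 : ℝ), (h q.1 + h2 q.1 + q.2) * f (Phi h h1 q.1 q.2) := by
  rw [← (Complex.volume_preserving_equiv_real_prod.symm).integral_comp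
    Complex.measurableEquivRealProd.symm.measurableEmbedding]
  have hs : MeasurableSet (Ioc (-π) π ×ˢ Ioi (0 : ℝ)) := measurableSet_Ioc.prod measurableSet_Ioi
  rw [← setIntegral_eq_integral_of_forall_compl_eq_zero (s :=
    (fun q : ℝ × ℝ => ((Phi h h1 q.1 q.2).re, (Phi h h1 q.1 q.2).im)) '' (Ioc (-π) π ×ˢ Ioi (0 : ℝ)))]
  · rw [integral_image_eq_integral_abs_det_fderiv_smul volume hs
      (fun q _ => (Phi_hasFDeriv H q).hasFDerivWithinAt)]
    · refine setIntegral_congr_fun hs fun q hq => ?_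
      have e := sin_sq_add_cos_sq q.1
      have hJ : 0 < h q.1 + h2 q.1 + q.2 := add_pos (H.pos _) hq.2
      simp only [LinearMap.det_toContinuousLinearMap, LinearMap.det_toLin, Matrix.det_fin_two_of,
        smul_eq_mul, Complex.measurableEquivRealProd_symm_apply]
      have : -(h q.1 + h2 q.1 + q.2) * sin q.1 * sin q.1 - cos q.1 * ((h q.1 + h2 q.1 + q.2) * cos q.1)
        = -(h q.1 + h2 q.1 + q.2) := by linear_combination (-(h q.1 + h2 q.1 + q.2)) * e
      rw [this, abs_neg, abs_of_pos hJ]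
    · rintro ⟨θ, t⟩ ⟨hθ, ht⟩ ⟨θ', t'⟩ ⟨hθ', ht'⟩ he
      simp only [Prod.mk.injEq] at he
      obtain ⟨e1, e2⟩ := H.inj hp hθ hθ' ht ht' (Complex.ext he.1 he.2)
      exact Prod.ext e1 e2
  · intro x hx
    apply hf
    by_contra hc
    obtain ⟨θ, hθ, t, ht, he⟩ := H.surj hp hc
    refine hx ⟨(θ, t), ⟨hθ, ht⟩, ?_⟩
    simp only [he]
    rfl

def phi (k : ℕ) (w : ℂ) : ℝ := ‖w‖ * ((w / ‖w‖) ^ k).re / (3 * k)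

lemma phi_pol (k : ℕ) (θ : ℝ) {t : ℝ} (ht : 0 < t) :
    phi k ⟨t * cos θ, t * sin θ⟩ = t * cos (k * θ) / (3 * k) := by
  rw [phi, norm_pol θ ht.le]
  have : (⟨t * cos θ, t * sin θ⟩ : ℂ) / t = Complex.exp (θ * Complex.I) := by
    have ht' : (t : ℂ) ≠ 0 := by exact_mod_cast ht.ne'
    rw [div_eq_iff ht']
    apply Complex.ext
    · simp [Complex.exp_ofReal_mul_I_re, Complex.exp_ofReal_mul_I_im]; ring
    · simp [Complex.exp_ofReal_mul_I_re, Complex.exp_ofReal_mul_I_im]; ring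
  rw [this, ← Complex.exp_nat_mul, ← mul_assoc]
  have : Complex.exp (k * θ * Complex.I) = Complex.exp (((k * θ : ℝ) : ℂ) * Complex.I) := by
    push_cast; rfl
  rw [this, Complex.exp_ofReal_mul_I_re]

lemma phi_zero (k : ℕ) : phi k 0 = 0 := by simp [phi]

lemma phi_smul (k : ℕ) {c : ℝ} (hc : 0 ≤ c) (w : ℂ) : phi k (c • w) = c * phi k w := by
  rcases hc.eq_or_lt with rfl | hc
  · simp [phi]
  · have : (c • w) / ((‖c • w‖ : ℝ) : ℂ) = w / (‖w‖ : ℝ) := by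
      rw [norm_smul, Real.norm_of_nonneg hc.le, Complex.real_smul]
      push_cast
      rw [mul_div_mul_left _ _ (by exact_mod_cast hc.ne')]
    rw [phi, this, norm_smul, Real.norm_of_nonneg hc.le, phi]; ring

lemma pow_sub_norm (k : ℕ) {a b : ℂ} (ha : ‖a‖ ≤ 1) (hb : ‖b‖ ≤ 1) : ‖a ^ k - b ^ k‖ ≤ k * ‖a - b‖ := by
  induction k with
  | zero => simp
  | succ k ih =>
    have : a ^ (k+1) - b ^ (k+1) = a ^ k * (a - b) + (a ^ k - b ^ k) * b := by ring
    rw [this]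
    refine (norm_add_le _ _).trans ?_
    rw [norm_mul, norm_mul, norm_pow]
    push_cast
    have h1 : ‖a‖ ^ k * ‖a - b‖ ≤ 1 * ‖a - b‖ := by
      gcongr; exact pow_le_one₀ (norm_nonneg _) ha
    have h2 : ‖a ^ k - b ^ k‖ * ‖b‖ ≤ k * ‖a - b‖ * 1 := by gcongr
    linarith

lemma norm_unit (w : ℂ) : ‖w / (‖w‖ : ℂ)‖ ≤ 1 := by
  rw [norm_div]; simp; exact div_self_le_one _

lemma phi_lip {k : ℕ} (hk : 1 ≤ k) (v w : ℂ) : |phi k v - phi k w| ≤ ‖v - w‖ := by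
  have hk' : (1 : ℝ) ≤ k := by exact_mod_cast hk
  set a := v / (‖v‖ : ℂ) with ha
  set b := w / (‖w‖ : ℂ) with hb
  have na : ‖a‖ ≤ 1 := norm_unit v
  have nb : ‖b‖ ≤ 1 := norm_unit w
  have hd := abs_norm_sub_norm_le v w
  have hva : (‖v‖ : ℂ) * a = v := by
    rcases eq_or_ne v 0 with h | h
    · simp [h]
    · rw [ha]; exact mul_div_cancel₀ _ (by simpa using h)
  have hwb : (‖w‖ : ℂ) * b = w := by
    rcases eq_or_ne w 0 with h | h
    · simp [h]
    · rw [hb]; exact mul_div_cancel₀ _ (by simpa using h)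
  have h1 : ‖v‖ * ‖a - b‖ ≤ 2 * ‖v - w‖ := by
    have : (‖v‖ : ℂ) * (a - b) = (v - w) + ((‖w‖ - ‖v‖ : ℝ) : ℂ) * b := by
      push_cast; linear_combination hva - hwb
    have h2 : ‖v‖ * ‖a - b‖ = ‖(‖v‖ : ℂ) * (a - b)‖ := by rw [norm_mul]; simp
    rw [h2, this]
    refine (norm_add_le _ _).trans ?_
    rw [norm_mul, Complex.norm_real, Real.norm_eq_abs, abs_sub_comm]
    have : |‖v‖ - ‖w‖| * ‖b‖ ≤ ‖v - w‖ * 1 := by gcongr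
    linarith
  have h3 : |(a ^ k).re - (b ^ k).re| ≤ k * ‖a - b‖ := by
    rw [← Complex.sub_re]
    exact (Complex.abs_re_le_norm _).trans (pow_sub_norm k na nb)
  have h4 : |(b ^ k).re| ≤ 1 := by
    refine (Complex.abs_re_le_norm _).trans ?_
    rw [norm_pow]; exact pow_le_one₀ (norm_nonneg _) nb
  have e : phi k v - phi k w = (‖v‖ * ((a ^ k).re - (b ^ k).re) + (‖v‖ - ‖w‖) * (b ^ k).re) / (3 * k) := by
    rw [phi, phi, ← ha, ← hb]; ring
  rw [e, abs_div, abs_of_pos (show (0:ℝ) < 3 * k by linarith), div_le_iff₀ (by linarith)]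
  refine (abs_add_le _ _).trans ?_
  rw [abs_mul, abs_mul, abs_of_nonneg (norm_nonneg v)]
  have h5 : ‖v‖ * |(a ^ k).re - (b ^ k).re| ≤ ‖v‖ * (k * ‖a - b‖) := by gcongr
  have h6 : |‖v‖ - ‖w‖| * |(b ^ k).re| ≤ ‖v - w‖ * 1 := by gcongr
  have h7 : k * (‖v‖ * ‖a - b‖) ≤ k * (2 * ‖v - w‖) := by gcongr
  nlinarith [norm_nonneg (v - w)]

lemma phi_abs {k : ℕ} (hk : 1 ≤ k) (v : ℂ) : |phi k v| ≤ ‖v‖ := by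
  simpa [phi_zero] using phi_lip hk v 0

lemma phi_meas (k : ℕ) : Measurable (phi k) := by
  unfold phi; fun_prop

lemma phi_cont {k : ℕ} (hk : 1 ≤ k) : Continuous (phi k) := by
  apply LipschitzWith.continuous (K := 1)
  apply LipschitzWith.of_dist_le_mul
  intro x y
  simpa [Real.dist_eq, dist_eq_norm] using phi_lip hk x y

def ff (ρ q t : ℝ) : ℝ := if t ^ 2 + q ≤ ρ ^ 2 then (√(t ^ 2 + q))⁻¹ * t else 0

lemma ff_meas (ρ q : ℝ) : Measurable (ff ρ q) := by
  unfold ff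
  refine Measurable.ite (measurableSet_le (by fun_prop) (by fun_prop)) (by fun_prop) (by fun_prop)

lemma ratio_le {q t : ℝ} (hq : 0 ≤ q) (ht : 0 ≤ t) : (√(t ^ 2 + q))⁻¹ * t ≤ 1 := by
  have h1 : t ≤ √(t ^ 2 + q) := Real.le_sqrt_of_sq_le (by linarith)
  rw [inv_mul_eq_div]
  exact div_le_one_of_le₀ h1 (Real.sqrt_nonneg _)

lemma ff_bd {ρ q t : ℝ} (hq : 0 ≤ q) (ht : 0 ≤ t) : ‖ff ρ q t‖ ≤ 1 := by
  unfold ff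
  split_ifs
  · rw [Real.norm_of_nonneg (by positivity)]; exact ratio_le hq ht
  · simp

lemma ff_zero {ρ q t : ℝ} (hρ : 0 < ρ) (hq : 0 ≤ q) (ht : 0 < t) (h : t ∉ Ioc 0 ρ) : ff ρ q t = 0 := by
  unfold ff
  rw [if_neg]
  intro hc
  apply h
  refine ⟨ht, ?_⟩
  nlinarith

lemma ff_int {ρ q : ℝ} (hρ : 0 < ρ) (hq : 0 ≤ q) : IntegrableOn (ff ρ q) (Ioi 0) := by
  have h1 : IntegrableOn (ff ρ q) (Ioc 0 ρ) := by
    refine Measure.integrableOn_of_bounded (M := 1) (by simp) (ff_meas ρ q).aestronglyMeasurable ?_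
    exact (ae_restrict_iff' measurableSet_Ioc).2 (Filter.Eventually.of_forall fun t ht => ff_bd hq ht.1.le)
  refine h1.of_forall_sdiff_eq_zero measurableSet_Ioi ?_
  intro t ht
  exact ff_zero hρ hq ht.1 ht.2

lemma ff_int' {ρ q : ℝ} (hρ : 0 < ρ) (hq : 0 ≤ q) : IntegrableOn (fun t => t * ff ρ q t) (Ioi 0) := by
  have h1 : IntegrableOn (fun t => t * ff ρ q t) (Ioc 0 ρ) := by
    refine Measure.integrableOn_of_bounded (M := ρ) (by simp)
      (measurable_id.mul (ff_meas ρ q)).aestronglyMeasurable ?_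
    refine (ae_restrict_iff' measurableSet_Ioc).2 (Filter.Eventually.of_forall fun t ht => ?_)
    rw [norm_mul, Real.norm_of_nonneg ht.1.le]
    have := ff_bd (ρ := ρ) hq ht.1.le
    calc t * ‖ff ρ q t‖ ≤ ρ * 1 := by
          apply mul_le_mul ht.2 this (norm_nonneg _) hρ.le
      _ = ρ := mul_one _
  refine h1.of_forall_sdiff_eq_zero measurableSet_Ioi ?_
  intro t ht
  simp [ff_zero hρ hq ht.1 ht.2]

lemma ff_integral {ρ q : ℝ} (hρ : 0 < ρ) (hq : 0 ≤ q) :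
    ∫ t in Ioi 0, ff ρ q t = max (ρ - √q) 0 := by
  rcases le_total (ρ ^ 2) q with h | h
  · have h1 : ρ ≤ √q := Real.le_sqrt_of_sq_le h
    rw [max_eq_right (by linarith)]
    apply setIntegral_eq_zero_of_forall_eq_zero
    intro t ht
    unfold ff
    rw [if_neg]
    have : 0 < t := ht
    nlinarith
  · have h1 : √q ≤ ρ := Real.sqrt_le_iff.2 ⟨hρ.le, h⟩
    rw [max_eq_left (by linarith)]
    set T := √(ρ ^ 2 - q) with hT
    have hT0 : 0 ≤ T := Real.sqrt_nonneg _
    have hT2 : T ^ 2 = ρ ^ 2 - q := Real.sq_sqrt (by linarith)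
    have e1 : ∫ t in Ioi 0, ff ρ q t = ∫ t in Ioc 0 T, ff ρ q t := by
      refine setIntegral_eq_of_subset_of_forall_sdiff_eq_zero measurableSet_Ioi Ioc_subset_Ioi_self ?_
      rintro t ⟨ht, ht2⟩
      have ht0 : 0 < t := ht
      have : T < t := by
        by_contra hc
        exact ht2 ⟨ht, not_lt.1 hc⟩
      unfold ff
      rw [if_neg]
      nlinarith
    have hle : ∀ t ∈ Ioc 0 T, ff ρ q t = (√(t ^ 2 + q))⁻¹ * t := by
      intro t ht
      unfold ff
      rw [if_pos]
      nlinarith [ht.1, ht.2]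
    rw [e1, ← intervalIntegral.integral_of_le hT0]
    have := intervalIntegral.integral_eq_sub_of_hasDerivAt_of_le (f := fun t => √(t ^ 2 + q))
      (f' := ff ρ q) hT0 (by fun_prop) (by
        intro t ht
        rw [hle t ⟨ht.1, ht.2.le⟩]
        have hp : t ^ 2 + q ≠ 0 := by nlinarith [ht.1]
        have := (((hasDerivAt_pow 2 t).add_const q).sqrt hp)
        refine this.congr_deriv ?_
        have : √(t ^ 2 + q) ≠ 0 := by
          rw [Real.sqrt_ne_zero']; nlinarith [ht.1]
        rw [div_eq_inv_mul, mul_inv]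
        push_cast
        ring
        ) (by
        rw [intervalIntegrable_iff_integrableOn_Ioc_of_le hT0]
        exact (ff_int hρ hq).mono_set Ioc_subset_Ioi_self)
    rw [this]
    simp only [hT2]
    norm_num
    rw [Real.sqrt_sq hρ.le]

lemma int_cos {k : ℕ} (hk : 1 ≤ k) : ∫ θ in Ioc (-π) π, cos (k * θ) = 0 := by
  have hk' : (k : ℝ) ≠ 0 := by positivity
  rw [← intervalIntegral.integral_of_le (by linarith [Real.pi_pos])]
  rw [intervalIntegral.integral_eq_sub_of_hasDerivAt (f := fun θ => sin (k * θ) / k)]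
  · have : sin (k * -π) = - sin (k * π) := by rw [mul_neg, sin_neg]
    simp [this, Real.sin_nat_mul_pi]
  · intro θ _
    have := (((hasDerivAt_id θ).const_mul (k : ℝ)).sin).div_const (k : ℝ)
    refine this.congr_deriv ?_
    simp
    field_simp
  · apply Continuous.intervalIntegrable; fun_prop

lemma int_cos2 {k : ℕ} (hk : 1 ≤ k) : ∫ θ in Ioc (-π) π, cos (k * θ) ^ 2 = π := by
  have hk' : (k : ℝ) ≠ 0 := by positivity
  rw [← intervalIntegral.integral_of_le (by linarith [Real.pi_pos])]
  rw [intervalIntegral.integral_eq_sub_of_hasDerivAt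
    (f := fun θ => θ / 2 + sin (k * θ) * cos (k * θ) / (2 * k))]
  · have : sin (k * -π) = - sin (k * π) := by rw [mul_neg, sin_neg]
    simp [this, Real.sin_nat_mul_pi]; ring
  · intro θ _
    have h0 := (hasDerivAt_id θ).const_mul (k : ℝ)
    have := ((hasDerivAt_id θ).div_const 2).add ((h0.sin.mul h0.cos).div_const (2 * (k : ℝ)))
    refine this.congr_deriv ?_
    simp
    field_simp
    have := sin_sq_add_cos_sq (k * θ)
    linear_combination (-1) * this
  · apply Continuous.intervalIntegrable; fun_prop

def hh (k : ℕ) (σ θ : ℝ) : ℝ := 1 / 4 * (1 + σ / k ^ 2 * cos (k * θ))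
def hh1 (k : ℕ) (σ θ : ℝ) : ℝ := 1 / 4 * (- σ / k * sin (k * θ))
def hh2 (k : ℕ) (σ θ : ℝ) : ℝ := 1 / 4 * (- σ * cos (k * θ))

lemma small_bd {k : ℕ} (hk : 1 ≤ k) {σ : ℝ} (h0 : 0 ≤ σ) (h1 : σ ≤ 1 / 2) (θ : ℝ) :
    |σ / k ^ 2 * cos (k * θ)| ≤ 1 / 2 / k ^ 2 ∧ |σ / k ^ 2 * cos (k * θ)| ≤ 1 / 2 ∧
    |- σ * cos (k * θ)| ≤ 1 / 2 := by
  have hk' : (1 : ℝ) ≤ k := by exact_mod_cast hk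
  have h2 : (1 : ℝ) ≤ k ^ 2 := one_le_pow₀ hk'
  have hc := abs_cos_le_one (k * θ)
  have e1 : |σ / k ^ 2 * cos (k * θ)| ≤ 1 / 2 / k ^ 2 := by
    rw [abs_mul, abs_of_nonneg (by positivity)]
    calc σ / k ^ 2 * |cos (k * θ)| ≤ (1 / 2) / k ^ 2 * 1 := by gcongr
      _ = _ := mul_one _
  refine ⟨e1, e1.trans (div_le_self (by norm_num) h2), ?_⟩
  rw [abs_mul, abs_neg, abs_of_nonneg h0]
  calc σ * |cos (k * θ)| ≤ (1 / 2) * 1 := by gcongr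
      _ = _ := mul_one _

lemma hh_SF {k : ℕ} (hk : 2 ≤ k) {σ : ℝ} (h0 : 0 ≤ σ) (h1 : σ ≤ 1 / 2) :
    SF (hh k σ) (hh1 k σ) (hh2 k σ) := by
  have hk' : (2 : ℝ) ≤ k := by exact_mod_cast hk
  refine ⟨fun θ => ?_, fun θ => ?_, fun θ => ?_, fun θ => ?_, fun θ => ?_⟩
  · have := ((((hasDerivAt_id θ).const_mul (k : ℝ)).cos.const_mul (σ / k ^ 2)).const_add 1).const_mul (1 / 4)
    refine this.congr_deriv ?_
    simp [hh1]
    field_simp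
  · have := ((((hasDerivAt_id θ).const_mul (k : ℝ)).sin.const_mul (-σ / k))).const_mul (1 / 4)
    refine this.congr_deriv ?_
    simp [hh2]
    field_simp
  · unfold hh
    rw [mul_add (k : ℝ), Real.cos_add_nat_mul_two_pi]
  · obtain ⟨_, _, e3⟩ := small_bd (k := k) (by omega) h0 h1 θ
    obtain ⟨e1, _, _⟩ := small_bd (k := k) (by omega) h0 h1 θ
    have : 1 / 2 / (k : ℝ) ^ 2 ≤ 1 / 8 := by
      rw [div_le_iff₀ (by positivity)]; nlinarith
    unfold hh hh2
    have a1 := (abs_le.1 e1).1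
    have a3 := (abs_le.1 e3).1
    linarith
  · obtain ⟨_, e2, _⟩ := small_bd (k := k) (by omega) h0 h1 θ
    unfold hh
    have a1 := (abs_le.1 e2).1
    linarith

lemma hh_le {k : ℕ} (hk : 1 ≤ k) {σ : ℝ} (h0 : 0 ≤ σ) (h1 : σ ≤ 1 / 2) (θ : ℝ) : hh k σ θ ≤ 1 / 2 := by
  obtain ⟨_, e2, _⟩ := small_bd (k := k) (by omega) h0 h1 θ
  unfold hh
  have a1 := (abs_le.1 e2).2
  linarith

/-- Fibre integrand. -/
def GG (k : ℕ) (p : ℂ → ℂ) (ρ : ℝ) (y : ℂ) (q : ℝ) : ℝ :=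
  if ‖y - p y‖ ^ 2 + q ≤ ρ ^ 2 then (√(‖y - p y‖ ^ 2 + q))⁻¹ * phi k (y - p y) else 0

lemma inner_int {k : ℕ} (hk : 2 ≤ k) {σ : ℝ} (h0 : 0 ≤ σ) (h1 : σ ≤ 1 / 2) {p : ℂ → ℂ}
    (hp : IsPr (AS (hh k σ)) p) {ρ q : ℝ} (hρ : 0 < ρ) (hq : 0 ≤ q) :
    ∫ y, GG k p ρ y q = - (σ * (1 - 1 / k ^ 2) * π / (12 * k)) * max (ρ - √q) 0 := by
  have H := hh_SF hk h0 h1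
  have hk0 : (k : ℝ) ≠ 0 := by positivity
  rw [H.cov hp _ (by intro y hy; simp [GG, hp.self hy, phi_zero])]
  have hs : MeasurableSet (Ioc (-π) π ×ˢ Ioi (0 : ℝ)) := measurableSet_Ioc.prod measurableSet_Ioi
  have e : ∫ z in Ioc (-π) π ×ˢ Ioi (0 : ℝ), (hh k σ z.1 + hh2 k σ z.1 + z.2) *
      GG k p ρ (Phi (hh k σ) (hh1 k σ) z.1 z.2) q =
      ∫ z in Ioc (-π) π ×ˢ Ioi (0 : ℝ), (cos (k * z.1) * ((1 / (12 * k)) * ff ρ q z.2 + (1 / (3 * k)) * (z.2 * ff ρ q z.2))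
       + (cos (k * z.1)) ^ 2 * (-(σ * (1 - 1 / k ^ 2) / (12 * k)) * ff ρ q z.2)) := by
    refine setIntegral_congr_fun hs fun z hz => ?_
    have ht : 0 < z.2 := hz.2
    simp only [GG]
    rw [H.pr_Phi hp z.1 ht.le, Phi_sub, norm_pol _ ht.le, phi_pol _ _ ht]
    unfold ff hh hh2
    split_ifs
    · field_simp; ring
    · simp
  rw [e, Measure.volume_eq_prod, ← Measure.prod_restrict, integral_add,
    integral_prod_mul (fun θ : ℝ => cos (k * θ)) (fun t => (1 / (12 * k)) * ff ρ q t + (1 / (3 * k)) * (t * ff ρ q t)),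
    integral_prod_mul (fun θ : ℝ => cos (k * θ) ^ 2) (fun t => -(σ * (1 - 1 / k ^ 2) / (12 * k)) * ff ρ q t),
    int_cos (by omega),
    int_cos2 (by omega), integral_const_mul, ff_integral hρ hq]
  · ring
  · refine Integrable.mul_prod (f := fun θ : ℝ => cos (k * θ)) (g := fun t => (1 / (12 * k)) * ff ρ q t + (1 / (3 * k)) * (t * ff ρ q t)) ?_ ?_
    · exact (Continuous.integrableOn_Ioc (by fun_prop))
    · exact ((ff_int hρ hq).const_mul _).add ((ff_int' hρ hq).const_mul _)
  · refine Integrable.mul_prod (f := fun θ : ℝ => cos (k * θ) ^ 2) (g := fun t => -(σ * (1 - 1 / k ^ 2) / (12 * k)) * ff ρ q t) ?_ ?_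
    · exact (Continuous.integrableOn_Ioc (by fun_prop))
    · exact ((ff_int hρ hq).const_mul _)

def clp (s z : ℝ) : ℝ := max 0 (min z s)

lemma clp_cont (s : ℝ) : Continuous (clp s) := by unfold clp; fun_prop

lemma clp_zero (z : ℝ) : clp 0 z = 0 := by
  unfold clp; exact max_eq_left (min_le_right _ _)

lemma clp_nn (s z : ℝ) : 0 ≤ clp s z := le_max_left _ _

lemma clp_le {s : ℝ} (hs : 0 ≤ s) (z : ℝ) : clp s z ≤ s := max_le hs (min_le_right _ _)

lemma clp_self {s z : ℝ} (h : 0 ≤ z) (h' : z ≤ s) : clp s z = z := by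
  unfold clp; rw [min_eq_left h', max_eq_right h]

lemma clp_min {s : ℝ} (hs : 0 ≤ s) (z : ℝ) {a : ℝ} (ha : 0 ≤ a) (ha' : a ≤ s) :
    (z - clp s z) ^ 2 ≤ (z - a) ^ 2 := by
  rcases le_total z 0 with h | h
  · have : clp s z = 0 := max_eq_left ((min_le_left _ _).trans h)
    rw [this]; nlinarith
  · rcases le_total z s with h' | h'
    · rw [clp_self h h']; simp; positivity
    · have : clp s z = s := by unfold clp; rw [min_eq_right h', max_eq_right hs]
      rw [this]; nlinarith

def JJ (s : ℝ) (d : ℕ) (F : ℝ → ℝ) : ℝ := ∫ z : Fin d → ℝ, F (∑ j, (z j - clp s (z j)) ^ 2)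

def Good (F : ℝ → ℝ) : Prop := Continuous F ∧ ∃ R, ∀ q, R ≤ q → F q = 0

lemma Good.shift {F : ℝ → ℝ} (hF : Good F) {a : ℝ} (ha : 0 ≤ a) : Good (fun q => F (a + q)) := by
  obtain ⟨h1, R, hR⟩ := hF
  exact ⟨by fun_prop, R, fun q hq => hR _ (by linarith)⟩

lemma Good.cs {F : ℝ → ℝ} (hF : Good F) {s : ℝ} (hs : 0 ≤ s) (d : ℕ) :
    Continuous (fun z : Fin d → ℝ => F (∑ j, (z j - clp s (z j)) ^ 2)) ∧
    HasCompactSupport (fun z : Fin d → ℝ => F (∑ j, (z j - clp s (z j)) ^ 2)) := by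
  obtain ⟨h1, R, hR⟩ := hF
  have := clp_cont s
  refine ⟨by fun_prop, HasCompactSupport.intro (isCompact_closedBall 0 (s + 1 + |R|)) ?_⟩
  intro z hz
  apply hR
  rw [mem_closedBall_zero_iff, pi_norm_le_iff_of_nonneg (by positivity)] at hz
  push Not at hz
  obtain ⟨j, hj⟩ := hz
  rw [Real.norm_eq_abs] at hj
  have e1 : (z j - clp s (z j)) ^ 2 ≤ ∑ j, (z j - clp s (z j)) ^ 2 :=
    Finset.single_le_sum (f := fun j => (z j - clp s (z j)) ^ 2) (fun _ _ => sq_nonneg _) (Finset.mem_univ j)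
  have e2 : 1 + |R| ≤ |z j - clp s (z j)| := by
    have := abs_sub_abs_le_abs_sub (z j) (clp s (z j))
    rw [abs_of_nonneg (clp_nn s (z j))] at this
    linarith [clp_le hs (z j)]
  have e3 : (1 + |R|) ^ 2 ≤ (z j - clp s (z j)) ^ 2 := by
    rw [← sq_abs (z j - clp s (z j))]
    gcongr
  nlinarith [abs_nonneg R, le_abs_self R]

lemma Good.int {F : ℝ → ℝ} (hF : Good F) {s : ℝ} (hs : 0 ≤ s) (d : ℕ) :
    Integrable (fun z : Fin d → ℝ => F (∑ j, (z j - clp s (z j)) ^ 2)) :=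
  (hF.cs hs d).1.integrable_of_hasCompactSupport (hF.cs hs d).2

lemma JJ_succ {F : ℝ → ℝ} (hF : Good F) {s : ℝ} (hs : 0 ≤ s) (d : ℕ) :
    Integrable (fun z : ℝ => JJ s d (fun q => F ((z - clp s z) ^ 2 + q))) ∧
    JJ s (d + 1) F = ∫ z : ℝ, JJ s d (fun q => F ((z - clp s z) ^ 2 + q)) := by
  have mp := (volume_preserving_piFinSuccAbove (fun _ : Fin (d + 1) => ℝ) 0).symm
  have me := (MeasurableEquiv.piFinSuccAbove (fun _ : Fin (d + 1) => ℝ) 0).symm.measurableEmbedding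
  have hi := (mp.integrable_comp_emb me).2 (hF.int hs (d + 1))
  have he : ((fun z : Fin (d + 1) → ℝ => F (∑ j, (z j - clp s (z j)) ^ 2)) ∘
      (MeasurableEquiv.piFinSuccAbove (fun _ : Fin (d + 1) => ℝ) 0).symm) =
      fun x : ℝ × (Fin d → ℝ) => F ((x.1 - clp s x.1) ^ 2 + ∑ j, (x.2 j - clp s (x.2 j)) ^ 2) := by
    ext x
    simp [Fin.sum_univ_succ, MeasurableEquiv.piFinSuccAbove]
  rw [he] at hi
  refine ⟨hi.integral_prod_left, ?_⟩
  rw [JJ, ← mp.integral_comp me]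
  have := congrArg (fun f => ∫ x, f x) he
  simp only [Function.comp_def] at this
  rw [this]
  exact integral_prod _ hi

lemma one_dim {f : ℝ → ℝ} (hf : Integrable (fun z : ℝ => f (z ^ 2))) {s : ℝ} (hs : 0 ≤ s) :
    Integrable (fun z : ℝ => f ((z - clp s z) ^ 2)) ∧
    ∫ z : ℝ, f ((z - clp s z) ^ 2) = s * f 0 + ∫ z : ℝ, f (z ^ 2) := by
  have a1 : EqOn (fun z : ℝ => f ((z - clp s z) ^ 2)) (fun z => f (z ^ 2)) (Iic 0) := by
    intro z hz
    have : clp s z = 0 := max_eq_left ((min_le_left _ _).trans hz)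
    simp [this]
  have a2 : EqOn (fun z : ℝ => f ((z - clp s z) ^ 2)) (fun z => f 0) (Ioc 0 s) := by
    intro z hz
    simp [clp_self hz.1.le hz.2]
  have a3 : EqOn (fun z : ℝ => f ((z - clp s z) ^ 2)) (fun z => f ((z - s) ^ 2)) (Ioi s) := by
    intro z hz
    have hz' : s < z := hz
    have : clp s z = s := by unfold clp; rw [min_eq_right hz'.le, max_eq_right hs]
    simp [this]
  have i1 : IntegrableOn (fun z : ℝ => f ((z - clp s z) ^ 2)) (Iic 0) :=
    hf.integrableOn.congr_fun a1.symm measurableSet_Iic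
  have i2 : IntegrableOn (fun z : ℝ => f ((z - clp s z) ^ 2)) (Ioc 0 s) :=
    (integrableOn_const (by simp) (by simp)).congr_fun a2.symm measurableSet_Ioc
  have i3 : IntegrableOn (fun z : ℝ => f ((z - clp s z) ^ 2)) (Ioi s) :=
    (hf.comp_sub_right s).integrableOn.congr_fun a3.symm measurableSet_Ioi
  have i23 : IntegrableOn (fun z : ℝ => f ((z - clp s z) ^ 2)) (Ioi 0) := by
    rw [← Ioc_union_Ioi_eq_Ioi hs]; exact i2.union i3
  have i : Integrable (fun z : ℝ => f ((z - clp s z) ^ 2)) := by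
    rw [← integrableOn_univ, ← Iic_union_Ioi (a := (0:ℝ))]; exact i1.union i23
  refine ⟨i, ?_⟩
  rw [← intervalIntegral.integral_Iic_add_Ioi i1 i23, ← intervalIntegral.integral_Iic_add_Ioi (b := 0) (f := fun z : ℝ => f (z ^ 2))
    hf.integrableOn hf.integrableOn, ← Ioc_union_Ioi_eq_Ioi hs, setIntegral_union
    (Set.Ioc_disjoint_Ioi le_rfl) measurableSet_Ioi i2 i3, Ioc_union_Ioi_eq_Ioi hs,
    setIntegral_congr_fun measurableSet_Iic a1, setIntegral_congr_fun measurableSet_Ioc a2,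
    setIntegral_congr_fun measurableSet_Ioi a3]
  have e : ∫ z in Ioi s, f ((z - s) ^ 2) = ∫ z in Ioi 0, f (z ^ 2) := by
    rw [← integral_indicator measurableSet_Ioi, ← integral_indicator measurableSet_Ioi,
      ← integral_sub_right_eq_self ((Ioi (0:ℝ)).indicator fun z => f (z ^ 2)) s]
    congr 1
    ext z
    by_cases h : s < z
    · rw [indicator_of_mem (by exact h), indicator_of_mem (by simpa using h)]
    · rw [indicator_of_notMem (by exact h), indicator_of_notMem (by simpa using h)]
  rw [e]
  simp [hs]
  ring

lemma JJ_expand {s : ℝ} (hs : 0 < s) (m : ℕ) : ∃ e : ℕ → ℝ, (∀ k ≤ m, 0 < e k) ∧ ∀ F, Good F →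
    JJ s m F = ∑ k ∈ Finset.range (m + 1), e k * JJ 0 (m - k) F := by
  induction m with
  | zero => exact ⟨fun _ => 1, by simp, fun F _ => by simp [JJ]⟩
  | succ m ih =>
    obtain ⟨e, he, hE⟩ := ih
    refine ⟨fun k => (if k ≤ m then e k else 0) + (if k = 0 then 0 else s * e (k - 1)), ?_, ?_⟩
    · intro k hk
      rcases Nat.eq_zero_or_pos k with rfl | h0
      · simpa using he 0 (by omega)
      · have h1 : 0 < s * e (k - 1) := mul_pos hs (he _ (by omega))
        have h2 : 0 ≤ (if k ≤ m then e k else 0) := by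
          split_ifs with h
          · exact (he k h).le
          · exact le_rfl
        simp only [h0.ne', if_false]
        linarith
    · intro F hF
      have key : ∀ d, Integrable (fun z : ℝ => JJ 0 d (fun q => F ((z - clp s z) ^ 2 + q))) ∧
          ∫ z : ℝ, JJ 0 d (fun q => F ((z - clp s z) ^ 2 + q)) = s * JJ 0 d F + JJ 0 (d + 1) F := by
        intro d
        obtain ⟨j1, j2⟩ := JJ_succ hF le_rfl d
        simp only [clp_zero, sub_zero] at j1 j2
        obtain ⟨k1, k2⟩ := one_dim (f := fun r => JJ 0 d (fun q => F (r + q))) j1 hs.le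
        refine ⟨k1, ?_⟩
        rw [k2, j2]
        simp
      rw [(JJ_succ hF hs.le m).2]
      have : ∀ z : ℝ, JJ s m (fun q => F ((z - clp s z) ^ 2 + q)) = ∑ k ∈ Finset.range (m + 1),
          e k * JJ 0 (m - k) (fun q => F ((z - clp s z) ^ 2 + q)) :=
        fun z => hE _ (hF.shift (sq_nonneg _))
      simp only [this]
      rw [integral_finsetSum _ (fun k _ => ((key (m - k)).1.const_mul _))]
      simp only [integral_const_mul, (key _).2, add_mul, Finset.sum_add_distrib, mul_add]
      rw [add_comm]
      congr 1
      · rw [Finset.sum_range_succ _ (m + 1)]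
        simp only [show ¬ (m + 1 ≤ m) by omega, if_false, zero_mul, add_zero]
        refine Finset.sum_congr rfl fun k hk => ?_
        have hk' : k ≤ m := by simpa [Nat.lt_succ_iff] using hk
        rw [if_pos hk', show m + 1 - k = m - k + 1 by omega]
      · rw [Finset.sum_range_succ' _ (m + 1)]
        simp only [if_true, zero_mul, add_zero]
        refine Finset.sum_congr rfl fun k hk => ?_
        simp
        ring

def Fr (ρ q : ℝ) : ℝ := max (ρ - √q) 0

lemma Fr_good {ρ : ℝ} : Good (Fr ρ) := by
  refine ⟨by unfold Fr; fun_prop, ρ ^ 2, fun q hq => ?_⟩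
  apply max_eq_right
  linarith [Real.le_sqrt_of_sq_le hq]

lemma JJ_Fr {ρ : ℝ} (hρ : 0 < ρ) (d : ℕ) : JJ 0 d (Fr ρ) = ρ ^ (d + 1) * JJ 0 d (Fr 1) := by
  have h := Measure.integral_comp_smul_of_nonneg (volume : Measure (Fin d → ℝ))
    (fun z : Fin d → ℝ => Fr ρ (∑ j, (z j - clp 0 (z j)) ^ 2)) ρ (hR := hρ.le)
  have e : ∀ z : Fin d → ℝ, Fr ρ (∑ j, ((ρ • z) j - clp 0 ((ρ • z) j)) ^ 2) =
      ρ * Fr 1 (∑ j, (z j - clp 0 (z j)) ^ 2) := by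
    intro z
    simp only [clp_zero, sub_zero, Pi.smul_apply, smul_eq_mul, mul_pow, ← Finset.mul_sum]
    unfold Fr
    rw [Real.sqrt_mul (sq_nonneg _), Real.sqrt_sq hρ.le, mul_max_of_nonneg _ _ hρ.le]
    congr 1 <;> ring
  simp only [e] at h
  rw [integral_const_mul] at h
  unfold JJ
  simp only [smul_eq_mul, Module.finrank_fintype_fun_eq_card, Fintype.card_fin] at h
  have : ρ ^ d ≠ 0 := by positivity
  rw [eq_inv_mul_iff_mul_eq₀ this] at h
  rw [← h]; ring

lemma JJ_pos (d : ℕ) : 0 < JJ 0 d (Fr 1) := by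
  have h := (Fr_good (ρ := 1)).cs le_rfl d (s := 0)
  refine h.1.integral_pos_of_hasCompactSupport_nonneg_nonzero h.2 (fun z => le_max_right _ _) (x := 0) ?_
  simp [Fr, clp_zero]

lemma kappa_pos (m : ℕ) : 0 < kappa m :=
  ENNReal.toReal_pos (measure_closedBall_pos _ _ one_pos).ne' measure_closedBall_lt_top.ne

lemma steiner_det (n : ℕ) : (steinerMatrix n).det ≠ 0 := by
  rcases Nat.eq_zero_or_pos n with rfl | hn
  · simp
  have hn' : (0:ℝ) < n := by exact_mod_cast hn
  let r : Fin n → ℝ := fun j => (j.1 + 1 : ℝ) / n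
  have hM : steinerMatrix n = Matrix.diagonal r * (Matrix.vandermonde r).submatrix id Fin.revPerm *
      Matrix.diagonal (fun i : Fin n => kappa (n - i.1)) := by
    ext j i
    rw [Matrix.mul_diagonal, Matrix.diagonal_mul]
    simp only [steinerMatrix, Matrix.of_apply, Matrix.submatrix_apply, Matrix.vandermonde_apply, id,
      Fin.revPerm_apply, Fin.val_rev]
    rw [← pow_succ']
    congr 2
    have := i.2
    omega
  rw [hM, Matrix.det_mul, Matrix.det_mul, Matrix.det_permute', Matrix.det_diagonal, Matrix.det_diagonal]
  refine mul_ne_zero (mul_ne_zero ?_ (mul_ne_zero ?_ ?_)) ?_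
  · exact Finset.prod_ne_zero_iff.2 fun j _ => by simp only [r]; positivity
  · rcases Int.units_eq_one_or (Equiv.Perm.sign (Fin.revPerm (n := n))) with h | h <;> rw [h] <;> simp
  · rw [Matrix.det_vandermonde_ne_zero_iff]
    intro a b hab
    simp only [r] at hab
    field_simp at hab
    have : (a.1:ℝ) = b.1 := by linarith
    exact Fin.ext (by exact_mod_cast this)
  · exact Finset.prod_ne_zero_iff.2 fun j _ => (kappa_pos _).ne'

lemma steiner_orth (n : ℕ) (i l : Fin n) : ∑ j : Fin n, steinerCoeff n i j *
    (((j.1 + 1 : ℝ) / n) ^ (n - l.1)) = if i = l then (kappa (n - l.1))⁻¹ else 0 := by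
  have h := congrFun (congrFun (Matrix.nonsing_inv_mul (steinerMatrix n)
    (isUnit_iff_ne_zero.2 (steiner_det n))) i) l
  rw [Matrix.mul_apply, Matrix.one_apply] at h
  have hk := (kappa_pos (n - l.1)).ne'
  have h2 : (∑ j : Fin n, steinerCoeff n i j * (((j.1 + 1 : ℝ) / n) ^ (n - l.1))) * kappa (n - l.1)
      = if i = l then 1 else 0 := by
    rw [← h, Finset.sum_mul]
    refine Finset.sum_congr rfl fun j _ => ?_
    simp only [steinerMatrix, Matrix.of_apply, steinerCoeff]
    ring
  rw [eq_div_of_mul_eq hk h2]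
  split_ifs <;> simp

lemma steiner_JJ (m : ℕ) {s : ℝ} (hs : 0 < s) (i : Fin (m + 2)) (hi : 1 ≤ i.1) :
    0 < ∑ j : Fin (m + 2), steinerCoeff (m + 2) i j *
      JJ s m (Fr ((j.1 + 1 : ℝ) / ((m + 2 : ℕ) : ℝ))) := by
  obtain ⟨e, he, hE⟩ := JJ_expand hs m
  have hi2 := i.2
  have : ∑ j : Fin (m + 2), steinerCoeff (m + 2) i j *
      JJ s m (Fr ((j.1 + 1 : ℝ) / ((m + 2 : ℕ) : ℝ))) =
      ∑ k ∈ Finset.range (m + 1), (e k * JJ 0 (m - k) (Fr 1)) *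
        (if i.1 = k + 1 then (kappa (m + 2 - (k + 1)))⁻¹ else 0) := by
    simp only [hE _ Fr_good, Finset.mul_sum]
    rw [Finset.sum_comm]
    refine Finset.sum_congr rfl fun k hk => ?_
    have hk' : k < m + 1 := by simpa using hk
    have ho := steiner_orth (m + 2) i ⟨k + 1, by omega⟩
    simp only [Fin.ext_iff] at ho
    rw [← ho, Finset.mul_sum]
    refine Finset.sum_congr rfl fun j _ => ?_
    rw [JJ_Fr (by positivity), show m + 2 - (k + 1) = m - k + 1 by omega]
    ring
  rw [this, Finset.sum_eq_single (i.1 - 1)]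
  · rw [if_pos (by omega)]
    exact mul_pos (mul_pos (he _ (by omega)) (JJ_pos _)) (inv_pos.2 (kappa_pos _))
  · intro k _ hk
    rw [if_neg (by omega), mul_zero]
  · intro h
    exact absurd (Finset.mem_range.2 (by omega)) h

def cpx {m : ℕ} (x : En (m + 2)) : ℂ := ⟨x 0, x 1⟩
def tau {m : ℕ} (x : En (m + 2)) : Fin m → ℝ := fun j => x j.succ.succ
def asm {m : ℕ} (y : ℂ) (z : Fin m → ℝ) : En (m + 2) := WithLp.toLp 2 (Fin.cons y.re (Fin.cons y.im z))

lemma cpx_asm {m : ℕ} (y : ℂ) (z : Fin m → ℝ) : cpx (asm y z) = y := by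
  apply Complex.ext <;> simp [cpx, asm]

lemma tau_asm {m : ℕ} (y : ℂ) (z : Fin m → ℝ) : tau (asm y z) = z := by
  ext j; simp [tau, asm]

lemma cpx_sub {m : ℕ} (a b : En (m + 2)) : cpx (a - b) = cpx a - cpx b := by
  apply Complex.ext <;> simp [cpx]

lemma cpx_smul {m : ℕ} (c : ℝ) (b : En (m + 2)) : cpx (c • b) = c • cpx b := by
  apply Complex.ext <;> simp [cpx]

lemma cpx_cont {m : ℕ} : Continuous (cpx : En (m + 2) → ℂ) := by
  have : (cpx : En (m + 2) → ℂ) = fun x => (x 0 : ℂ) + (x 1 : ℂ) * Complex.I := by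
    ext x; apply Complex.ext <;> simp [cpx]
  rw [this]; fun_prop

lemma tau_cont {m : ℕ} : Continuous (tau : En (m + 2) → Fin m → ℝ) := by
  unfold tau; fun_prop

lemma norm_split {m : ℕ} (x : En (m + 2)) : ‖x‖ ^ 2 = ‖cpx x‖ ^ 2 + ∑ j, tau x j ^ 2 := by
  rw [EuclideanSpace.norm_sq_eq, nsq, Fin.sum_univ_succ, Fin.sum_univ_succ]
  simp [cpx, tau, add_assoc]

def toProd (m : ℕ) : En (m + 2) ≃ᵐ ℂ × (Fin m → ℝ) :=
  (MeasurableEquiv.toLp 2 (Fin (m + 2) → ℝ)).symm.trans <|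
  (MeasurableEquiv.piFinSuccAbove (fun _ : Fin (m + 2) => ℝ) 0).trans <|
  (MeasurableEquiv.prodCongr (MeasurableEquiv.refl ℝ)
    (MeasurableEquiv.piFinSuccAbove (fun _ : Fin (m + 1) => ℝ) 0)).trans <|
  MeasurableEquiv.prodAssoc.symm.trans <|
  MeasurableEquiv.prodCongr Complex.measurableEquivRealProd.symm (MeasurableEquiv.refl _)

lemma toProd_apply {m : ℕ} (x : En (m + 2)) : toProd m x = (cpx x, tau x) := by
  refine Prod.ext ?_ ?_
  · apply Complex.ext
    · rfl
    · rfl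
  · rfl

lemma toProd_mp (m : ℕ) : MeasurePreserving (toProd m) volume volume := by
  have h1 := EuclideanSpace.volume_preserving_symm_measurableEquiv_toLp (Fin (m + 2))
  have h2 := volume_preserving_piFinSuccAbove (fun _ : Fin (m + 2) => ℝ) 0
  have h3 := (MeasurePreserving.id (volume : Measure ℝ)).prod
    (volume_preserving_piFinSuccAbove (fun _ : Fin (m + 1) => ℝ) 0)
  have h4 := (volume_preserving_prodAssoc (α₁ := ℝ) (β₁ := ℝ) (γ₁ := Fin m → ℝ)).symm
  have h5 := (Complex.volume_preserving_equiv_real_prod.symm).prod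
    (MeasurePreserving.id (volume : Measure (Fin m → ℝ)))
  exact h5.comp (h4.comp (h3.comp (h2.comp h1)))

lemma int_split {m : ℕ} (f : ℂ × (Fin m → ℝ) → ℝ) :
    ∫ x : En (m + 2), f (cpx x, tau x) = ∫ w, f w := by
  rw [← (toProd_mp m).integral_comp (toProd m).measurableEmbedding]
  simp only [toProd_apply]

def KK (m : ℕ) (A : Set ℂ) (s : ℝ) : Set (En (m + 2)) :=
  {x | cpx x ∈ A ∧ ∀ j, 0 ≤ tau x j ∧ tau x j ≤ s}

def pKK (m : ℕ) (p : ℂ → ℂ) (s : ℝ) (x : En (m + 2)) : En (m + 2) :=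
  asm (p (cpx x)) (fun j => clp s (tau x j))

/-- squared distance -/
def dsq {m : ℕ} (p : ℂ → ℂ) (s : ℝ) (x : En (m + 2)) : ℝ :=
  ‖cpx x - p (cpx x)‖ ^ 2 + ∑ j, (tau x j - clp s (tau x j)) ^ 2

lemma pKK_mem {m : ℕ} {A : Set ℂ} {p : ℂ → ℂ} (hp : IsPr A p) {s : ℝ} (hs : 0 ≤ s) (x : En (m + 2)) :
    pKK m p s x ∈ KK m A s := by
  refine ⟨?_, fun j => ?_⟩
  · rw [pKK, cpx_asm]; exact hp.1 _
  · rw [pKK, tau_asm]; exact ⟨clp_nn _ _, clp_le hs _⟩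

lemma tau_sub {m : ℕ} (a b : En (m + 2)) (j) : tau (a - b) j = tau a j - tau b j := by
  simp [tau]

lemma dist_pKK {m : ℕ} (p : ℂ → ℂ) (s : ℝ) (x : En (m + 2)) : dist x (pKK m p s x) = √(dsq p s x) := by
  rw [dist_eq_norm, eq_comm, Real.sqrt_eq_iff_mul_self_eq (by unfold dsq; positivity) (norm_nonneg _), ← sq,
    norm_split, cpx_sub]
  simp only [tau_sub, pKK, cpx_asm, tau_asm, dsq]

lemma dist_min {m : ℕ} {A : Set ℂ} {p : ℂ → ℂ} (hp : IsPr A p) {s : ℝ} (hs : 0 ≤ s) (x : En (m + 2))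
    {a : En (m + 2)} (ha : a ∈ KK m A s) : √(dsq p s x) ≤ dist x a := by
  rw [dist_eq_norm]
  apply Real.sqrt_le_iff.2 ⟨norm_nonneg _, ?_⟩
  rw [norm_split, cpx_sub, dsq]
  simp only [tau_sub]
  refine add_le_add (hp.min _ ha.1) (Finset.sum_le_sum fun j _ => ?_)
  exact clp_min hs _ (ha.2 j).1 (ha.2 j).2

lemma infDist_KK {m : ℕ} {A : Set ℂ} {p : ℂ → ℂ} (hp : IsPr A p) {s : ℝ} (hs : 0 ≤ s) (x : En (m + 2)) :
    infDist x (KK m A s) = √(dsq p s x) := by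
  apply le_antisymm
  · rw [← dist_pKK]; exact infDist_le_dist_of_mem (pKK_mem hp hs x)
  · exact (le_infDist ⟨_, pKK_mem hp hs x⟩).2 fun _ ha => dist_min hp hs x ha

lemma proj_KK {m : ℕ} {A : Set ℂ} {p : ℂ → ℂ} (hp : IsPr A p) {s : ℝ} (hs : 0 ≤ s) :
    IsMetricProj (KK m A s) (pKK m p s) := fun x =>
  ⟨pKK_mem hp hs x, by rw [infDist_KK hp hs, dist_pKK]⟩

lemma KK_closed {m : ℕ} {A : Set ℂ} (hA : IsClosed A) (s : ℝ) : IsClosed (KK m A s) := by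
  have : KK m A s = cpx ⁻¹' A ∩ tau ⁻¹' (Icc (fun _ => 0) (fun _ => s)) := by
    ext x
    simp only [KK, mem_ofPred_eq, mem_inter_iff, mem_preimage, mem_Icc, Pi.le_def, forall_and]
  rw [this]
  exact (hA.preimage cpx_cont).inter (isClosed_Icc.preimage tau_cont)

lemma KK_ball {m : ℕ} {A : Set ℂ} (hA : ∀ y ∈ A, ‖y‖ ≤ 1 / 2) {s : ℝ} (hs : s = 1 / (2 * (m + 1))) :
    KK m A s ⊆ closedBall 0 1 := by
  intro x hx
  rw [mem_closedBall_zero_iff]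
  have h1 := hA _ hx.1
  have h2 : ∑ j, tau x j ^ 2 ≤ ∑ j : Fin m, s ^ 2 := by
    gcongr with j
    · exact (hx.2 j).1
    · exact (hx.2 j).2
  have h3 : (m : ℝ) * s ^ 2 ≤ 1 / 4 := by
    rw [hs]
    have : (0:ℝ) ≤ m := by positivity
    rw [div_pow, one_pow, mul_one_div, div_le_div_iff₀ (by positivity) (by positivity)]
    nlinarith
  simp at h2
  have h4 := norm_split x
  have : ‖cpx x‖ ^ 2 ≤ (1 / 2) ^ 2 := by gcongr
  nlinarith [norm_nonneg x]

lemma KK_convex {m : ℕ} {A : Set ℂ} (hA : Convex ℝ A) (s : ℝ) : Convex ℝ (KK m A s) := by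
  intro x hx y hy a b ha hb hab
  refine ⟨?_, fun j => ?_⟩
  · have : cpx (a • x + b • y) = a • cpx x + b • cpx y := by
      apply Complex.ext <;> simp [cpx]
    rw [this]
    exact hA hx.1 hy.1 ha hb hab
  · have : tau (a • x + b • y) j = a * tau x j + b * tau y j := by simp [tau]
    rw [this]
    have h1 := hx.2 j
    have h2 := hy.2 j
    constructor
    · nlinarith
    · have : s = a * s + b * s := by rw [← add_mul, hab, one_mul]
      rw [this]
      nlinarith

lemma KK_body {m : ℕ} {A : Set ℂ} (hA : IsClosed A) (hc : Convex ℝ A) {p : ℂ → ℂ} (hp : IsPr A p)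
    (hn : ∀ y ∈ A, ‖y‖ ≤ 1 / 2) {s : ℝ} (hs : s = 1 / (2 * (m + 1))) : IsConvexBody (KK m A s) :=
  ⟨⟨_, pKK_mem hp (by rw [hs]; positivity) 0⟩,
    Metric.isCompact_of_isClosed_isBounded (KK_closed hA s) (isBounded_closedBall.subset (KK_ball hn hs)),
    KK_convex hc s⟩

lemma g_BL {m k : ℕ} (hk : 1 ≤ k) : IsSphereBLFun (fun v : En (m + 2) => phi k (cpx v)) := by
  have h : ∀ v : En (m + 2), ‖cpx v‖ ≤ ‖v‖ := by
    intro v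
    have := norm_split v
    have h2 : 0 ≤ ∑ j, tau v j ^ 2 := by positivity
    exact le_of_sq_le_sq (by linarith) (norm_nonneg _)
  refine ⟨fun a b _ _ => ?_, fun a ha => ?_⟩
  · refine (phi_lip hk _ _).trans ?_
    rw [← cpx_sub]; exact h _
  · refine (phi_abs hk _).trans ?_
    rw [← ha]; exact h _

lemma mem_pbody {m : ℕ} {A : Set ℂ} {p : ℂ → ℂ} (hp : IsPr A p) {s : ℝ} (hs : 0 ≤ s) {ρ : ℝ} (hρ : 0 < ρ)
    (x : En (m + 2)) : x ∈ pbody (KK m A s) ρ ↔ dsq p s x ≤ ρ ^ 2 := by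
  rw [← Real.sqrt_le_left hρ.le]
  constructor
  · rintro ⟨a, ha, b, hb, rfl⟩
    refine (dist_min hp hs _ ha).trans ?_
    simpa using hb
  · intro h
    refine ⟨pKK m p s x, pKK_mem hp hs x, x - pKK m p s x, ?_, by simp⟩
    rw [mem_closedBall_zero_iff, ← dist_eq_norm, dist_pKK]
    exact h

lemma dsq_cont {m : ℕ} {A : Set ℂ} {p : ℂ → ℂ} (hp : IsPr A p) (s : ℝ) :
    Continuous (dsq p s : En (m + 2) → ℝ) := by
  have := hp.continuous
  have := clp_cont s
  have := cpx_cont (m := m)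
  unfold dsq tau
  fun_prop

lemma shell_int {m k : ℕ} {A : Set ℂ} (hA : IsClosed A) {p : ℂ → ℂ} (hp : IsPr A p) {s : ℝ} (hs : 0 ≤ s)
    {ρ : ℝ} (hρ : 0 < ρ) :
    ∫ x in shell (KK m A s) ρ, phi k (cpx (uvec (KK m A s) (pKK m p s) x)) =
    ∫ w : ℂ × (Fin m → ℝ), GG k p ρ w.1 (∑ j, (w.2 j - clp s (w.2 j)) ^ 2) := by
  have hpb : pbody (KK m A s) ρ = {x | dsq p s x ≤ ρ ^ 2} := by
    ext x; exact mem_pbody hp hs hρ x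
  have hm : MeasurableSet (shell (KK m A s) ρ) := by
    unfold shell
    rw [hpb]
    exact (isClosed_le (dsq_cont hp s) continuous_const).measurableSet.diff (KK_closed hA s).measurableSet
  rw [← integral_indicator hm, ← int_split (fun w => GG k p ρ w.1 (∑ j, (w.2 j - clp s (w.2 j)) ^ 2))]
  congr 1
  ext x
  have hu : phi k (cpx (uvec (KK m A s) (pKK m p s) x)) =
      (√(dsq p s x))⁻¹ * phi k (cpx x - p (cpx x)) := by
    rw [uvec, infDist_KK hp hs, cpx_smul, phi_smul k (by positivity), cpx_sub, pKK, cpx_asm]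
  have hG : GG k p ρ (cpx x) (∑ j, (tau x j - clp s (tau x j)) ^ 2) =
      if dsq p s x ≤ ρ ^ 2 then (√(dsq p s x))⁻¹ * phi k (cpx x - p (cpx x)) else 0 := rfl
  by_cases h : x ∈ shell (KK m A s) ρ
  · rw [indicator_of_mem h, hu, hG, if_pos]
    exact (mem_pbody hp hs hρ x).1 h.1
  · rw [indicator_of_notMem h, hG]
    split_ifs with h'
    · have : x ∈ KK m A s := by
        by_contra hx
        exact h ⟨(mem_pbody hp hs hρ x).2 h', hx⟩
      rw [hp.self this.1, sub_self, phi_zero, mul_zero]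
    · rfl

lemma fubini_GG {m k : ℕ} (hk : 2 ≤ k) {σ : ℝ} (h0 : 0 ≤ σ) (h1 : σ ≤ 1 / 2) {p : ℂ → ℂ}
    (hp : IsPr (AS (hh k σ)) p) {s : ℝ} (hs : 0 ≤ s) {ρ : ℝ} (hρ : 0 < ρ) :
    ∫ w : ℂ × (Fin m → ℝ), GG k p ρ w.1 (∑ j, (w.2 j - clp s (w.2 j)) ^ 2) =
    - (σ * (1 - 1 / k ^ 2) * π / (12 * k)) * JJ s m (Fr ρ) := by
  have cp := hp.continuous
  have cc := clp_cont s
  have hint : Integrable (fun w : ℂ × (Fin m → ℝ) => GG k p ρ w.1 (∑ j, (w.2 j - clp s (w.2 j)) ^ 2))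
      (volume.prod volume) := by
    have hmeas : Measurable (fun w : ℂ × (Fin m → ℝ) => GG k p ρ w.1 (∑ j, (w.2 j - clp s (w.2 j)) ^ 2)) := by
      have c1 : Continuous (fun w : ℂ × (Fin m → ℝ) =>
        ‖w.1 - p w.1‖ ^ 2 + ∑ j, (w.2 j - clp s (w.2 j)) ^ 2) := by fun_prop
      have c2 : Continuous (fun w : ℂ × (Fin m → ℝ) => phi k (w.1 - p w.1)) :=
        (phi_cont (by omega)).comp (by fun_prop)
      unfold GG
      exact Measurable.ite (measurableSet_le c1.measurable measurable_const)
        ((Real.continuous_sqrt.comp c1).measurable.inv.mul c2.measurable) measurable_const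
    have hb : ∀ w : ℂ × (Fin m → ℝ), ‖GG k p ρ w.1 (∑ j, (w.2 j - clp s (w.2 j)) ^ 2)‖ ≤ 1 := by
      intro w
      unfold GG
      split_ifs
      · rw [norm_mul, Real.norm_of_nonneg (by positivity)]
        refine le_trans ?_ (ratio_le (q := ∑ j, (w.2 j - clp s (w.2 j)) ^ 2) (t := ‖w.1 - p w.1‖)
          (by positivity) (norm_nonneg _))
        gcongr
        exact phi_abs (by omega) _
      · simp
    set S : Set (ℂ × (Fin m → ℝ)) := closedBall 0 (1 / 2 + s + ρ) with hS
    have hSI : IntegrableOn (fun w : ℂ × (Fin m → ℝ) => GG k p ρ w.1 (∑ j, (w.2 j - clp s (w.2 j)) ^ 2)) S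
        (volume.prod volume) := by
      refine Measure.integrableOn_of_bounded (M := 1) ?_ hmeas.aestronglyMeasurable
        (Filter.Eventually.of_forall hb)
      exact (measure_closedBall_lt_top (μ := (volume : Measure (ℂ × (Fin m → ℝ))))).ne
    rw [← integrableOn_univ]
    refine hSI.of_forall_sdiff_eq_zero MeasurableSet.univ ?_
    intro w hw
    unfold GG
    rw [if_neg]
    intro hle
    apply hw.2
    have hsn : 0 ≤ ∑ j, (w.2 j - clp s (w.2 j)) ^ 2 := by positivity
    rw [hS, mem_closedBall_zero_iff, Prod.norm_def, max_le_iff]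
    constructor
    · have e1 : ‖w.1 - p w.1‖ ≤ ρ := le_of_sq_le_sq (by linarith) hρ.le
      have e2 : ‖p w.1‖ ≤ 1 / 2 := AS_norm (hh_le (by omega) h0 h1) (hp.1 _)
      have e3 := norm_le_norm_sub_add w.1 (p w.1)
      linarith
    · rw [pi_norm_le_iff_of_nonneg (by positivity)]
      intro j
      have e1 : (w.2 j - clp s (w.2 j)) ^ 2 ≤ ∑ j, (w.2 j - clp s (w.2 j)) ^ 2 :=
        Finset.single_le_sum (f := fun j => (w.2 j - clp s (w.2 j)) ^ 2) (fun _ _ => sq_nonneg _)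
          (Finset.mem_univ j)
      have e2 : |w.2 j - clp s (w.2 j)| ≤ ρ := by
        apply abs_le_of_sq_le_sq _ hρ.le
        have : 0 ≤ ‖w.1 - p w.1‖ ^ 2 := by positivity
        linarith
      have e3 := clp_nn s (w.2 j)
      have e4 := clp_le hs (w.2 j)
      rw [Real.norm_eq_abs, abs_le]
      have := abs_le.1 e2
      constructor <;> linarith
  rw [Measure.volume_eq_prod, integral_prod_symm _ hint, JJ, ← integral_const_mul]
  congr 1
  ext z
  exact inner_int hk h0 h1 hp hρ (q := ∑ j, (z j - clp s (z j)) ^ 2) (by positivity)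

lemma T_val {m k : ℕ} (hk : 2 ≤ k) {σ : ℝ} (h0 : 0 ≤ σ) (h1 : σ ≤ 1 / 2) {p : ℂ → ℂ}
    (hp : IsPr (AS (hh k σ)) p) {s : ℝ} (hs : 0 ≤ s) (i : Fin (m + 2)) :
    ∑ j : Fin (m + 2), steinerCoeff (m + 2) i j *
      ∫ x in shell (KK m (AS (hh k σ)) s) ((j.1 + 1 : ℝ) / ((m + 2 : ℕ) : ℝ)),
        phi k (cpx (uvec (KK m (AS (hh k σ)) s) (pKK m p s) x)) =
    - (σ * (1 - 1 / k ^ 2) * π / (12 * k)) * ∑ j : Fin (m + 2), steinerCoeff (m + 2) i j *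
      JJ s m (Fr ((j.1 + 1 : ℝ) / ((m + 2 : ℕ) : ℝ))) := by
  rw [Finset.mul_sum]
  refine Finset.sum_congr rfl fun j _ => ?_
  rw [shell_int (AS_closed _) hp hs (by positivity), fubini_GG hk h0 h1 hp hs (by positivity)]
  ring

lemma KK_near {m : ℕ} {h h1 h2 k : ℝ → ℝ} (H : SF h h1 h2) {p : ℂ → ℂ} (hp : IsPr (AS h) p) {δ : ℝ}
    (hδ : 0 ≤ δ) (hk : ∀ θ, k θ ≤ h θ + δ) {s : ℝ} {x : En (m + 2)} (hx : x ∈ KK m (AS k) s) :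
    ∃ y ∈ KK m (AS h) s, dist x y ≤ δ := by
  refine ⟨asm (p (cpx x)) (tau x), ⟨by rw [cpx_asm]; exact hp.1 _, by rw [tau_asm]; exact hx.2⟩, ?_⟩
  rw [dist_eq_norm]
  refine le_of_sq_le_sq ?_ hδ
  rw [norm_split, cpx_sub, cpx_asm]
  simp only [tau_sub, tau_asm, sub_self]
  have := H.dist_le hp hδ hk hx.1
  simp
  gcongr

lemma choose_k {c α C : ℝ} (hα : 1 / 2 < α) (hC : 0 < C) :
    ∃ k : ℕ, 2 ≤ k ∧ c * (1 / (k : ℝ) ^ 2) ^ α < C / k := by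
  have ht : Filter.Tendsto (fun k : ℕ => c * (k : ℝ) ^ (-(2 * α - 1))) Filter.atTop (nhds (c * 0)) :=
    ((tendsto_rpow_neg_atTop (by linarith)).comp tendsto_natCast_atTop_atTop).const_mul c
  rw [mul_zero] at ht
  obtain ⟨k, hk, hk2⟩ := ((ht.eventually_lt_const hC).and (Filter.eventually_ge_atTop 2)).exists
  refine ⟨k, hk2, ?_⟩
  have k0 : (0:ℝ) < k := by positivity
  rw [lt_div_iff₀ k0]
  convert hk using 1
  rw [mul_assoc]
  congr 1
  rw [one_div, ← Real.rpow_natCast, ← Real.rpow_neg k0.le, ← Real.rpow_mul k0.le]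
  nth_rw 2 [← Real.rpow_one (k : ℝ)]
  rw [← Real.rpow_add k0]
  congr 1
  push_cast
  ring

/-- Optimality of the exponent 1/2: for `1 ≤ i ≤ n-1`, no estimate
`d_bL(Ψ_i(K,·), Ψ_i(L,·)) ≤ c · d_H(K,L)^α` with `α > 1/2` can hold, where
`Ψ_i(K,·) = (π₂)_# Λ_i(K,·)`.  Here `d_bL(μ,ν) > v` is expressed through the
existence of a test function `g` witnessing it. -/
theorem holder_exponent_optimal (n : ℕ) (hn : 2 ≤ n) (i : ℕ) (hi1 : 1 ≤ i)
    (hi2 : i ≤ n - 1) (c : ℝ) (hc : 0 < c) (α : ℝ) (hα : 1 / 2 < α) :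
    ∃ K L : Set (En n), IsConvexBody K ∧ IsConvexBody L ∧
      K ⊆ Metric.closedBall (0 : En n) 1 ∧ L ⊆ Metric.closedBall (0 : En n) 1 ∧ K ≠ L ∧
      ∃ pK pL : En n → En n, IsMetricProj K pK ∧ IsMetricProj L pL ∧
        ∃ g : En n → ℝ, IsSphereBLFun g ∧
          c * Metric.hausdorffDist K L ^ α <
            |(∑ j : Fin n, steinerCoeff n ⟨i, by omega⟩ j *
                ∫ x in shell K ((j.1 + 1 : ℝ) / n), g (uvec K pK x)) -
              (∑ j : Fin n, steinerCoeff n ⟨i, by omega⟩ j *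
                ∫ x in shell L ((j.1 + 1 : ℝ) / n), g (uvec L pL x))| := by


  obtain ⟨m, rfl⟩ : ∃ m, n = m + 2 := ⟨n - 2, by omega⟩
  set s : ℝ := 1 / (2 * (m + 1)) with hs
  have hs0 : 0 < s := by positivity
  set P := ∑ j : Fin (m + 2), steinerCoeff (m + 2) ⟨i, by omega⟩ j *
      JJ s m (Fr ((j.1 + 1 : ℝ) / ((m + 2 : ℕ) : ℝ))) with hP
  have hP0 : 0 < P := steiner_JJ m hs0 ⟨i, by omega⟩ hi1
  obtain ⟨k, hk, hkC⟩ := choose_k (c := c) hα (C := 1 / 2 * (3 / 4) * π / 12 * P)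
    (by have := Real.pi_pos; positivity)
  have hk' : (2 : ℝ) ≤ k := by exact_mod_cast hk
  have a1 : (0:ℝ) ≤ 1 / 2 := by norm_num
  have a2 : (1:ℝ) / 2 ≤ 1 / 2 := le_rfl
  have b1 : (0:ℝ) ≤ 0 := le_rfl
  have b2 : (0:ℝ) ≤ 1 / 2 := by norm_num
  have HK := hh_SF hk a1 a2
  have HL := hh_SF hk b1 b2
  have nK := hh_le (k := k) (by omega) a1 a2
  have nL := hh_le (k := k) (by omega) b1 b2
  obtain ⟨p, hp⟩ := exists_isPr (AS_compact nK) (AS_convex _) ⟨_, HK.gam_mem 0⟩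
  obtain ⟨q, hq⟩ := exists_isPr (AS_compact nL) (AS_convex _) ⟨_, HL.gam_mem 0⟩
  refine ⟨KK m (AS (hh k (1 / 2))) s, KK m (AS (hh k 0)) s,
    KK_body (AS_closed _) (AS_convex _) hp (fun y hy => AS_norm nK hy) hs,
    KK_body (AS_closed _) (AS_convex _) hq (fun y hy => AS_norm nL hy) hs,
    KK_ball (fun y hy => AS_norm nK hy) hs, KK_ball (fun y hy => AS_norm nL hy) hs, ?_,
    pKK m p s, pKK m q s, proj_KK hp hs0.le, proj_KK hq hs0.le,
    fun v => phi k (cpx v), g_BL (by omega), ?_⟩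
  · intro he
    have hx : asm (gam (hh k (1 / 2)) (hh1 k (1 / 2)) 0) (fun _ => 0) ∈ KK m (AS (hh k (1 / 2))) s := by
      refine ⟨by rw [cpx_asm]; exact HK.gam_mem 0, fun j => ?_⟩
      rw [tau_asm]; exact ⟨le_rfl, hs0.le⟩
    rw [he] at hx
    have h3 := hx.1
    rw [cpx_asm] at h3
    have h4 := h3 0
    simp [gam, hh] at h4
    have : (0:ℝ) < 2⁻¹ / k ^ 2 := by positivity
    linarith
  · rw [T_val hk a1 a2 hp hs0.le, T_val hk b1 b2 hq hs0.le, ← hP]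
    have hd : hausdorffDist (KK m (AS (hh k (1 / 2))) s) (KK m (AS (hh k 0)) s) ≤ 1 / (k : ℝ) ^ 2 := by
      have hb : ∀ θ, |1 / 2 / (k : ℝ) ^ 2 * cos (k * θ)| ≤ 1 / 2 / (k : ℝ) ^ 2 := fun θ =>
        (small_bd (k := k) (by omega) a1 a2 θ).1
      have hδ : (1:ℝ) / 2 / k ^ 2 ≤ 1 / k ^ 2 := by gcongr; norm_num
      have hδ0 : (0:ℝ) ≤ 1 / 2 / k ^ 2 := by positivity
      refine hausdorffDist_le_of_mem_dist (by positivity) ?_ ?_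
      · intro x hx
        refine KK_near HL hq (by positivity) (fun θ => ?_) hx
        have := abs_le.1 (hb θ)
        simp only [hh, zero_div, zero_mul, add_zero]
        linarith
      · intro x hx
        refine KK_near HK hp (by positivity) (fun θ => ?_) hx
        have := abs_le.1 (hb θ)
        simp only [hh, zero_div, zero_mul, add_zero]
        linarith
    have h5 : c * hausdorffDist (KK m (AS (hh k (1 / 2))) s) (KK m (AS (hh k 0)) s) ^ α ≤
        c * (1 / (k : ℝ) ^ 2) ^ α := by
      gcongr
      exact hausdorffDist_nonneg
    refine h5.trans_lt (hkC.trans_le ?_)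
    have h6 : (3:ℝ) / 4 ≤ 1 - 1 / k ^ 2 := by
      have : (1:ℝ) / k ^ 2 ≤ 1 / 2 ^ 2 := by gcongr
      linarith
    have e : -(1 / 2 * (1 - 1 / (k:ℝ) ^ 2) * π / (12 * k)) * P - -(0 * (1 - 1 / (k:ℝ) ^ 2) * π / (12 * k)) * P
        = - (1 / 2 * (1 - 1 / (k:ℝ) ^ 2) * π / 12 * P / k) := by
      field_simp
      ring
    rw [e, abs_neg]
    refine le_trans ?_ (le_abs_self _)
    have := Real.pi_pos
    gcongr

end
end

section
/- Let n ≥ 1, let h ∈ (0, π/2), let N ∈ ℕ, and let e₁, …, e_N be unit vectors in ℝⁿ. Set P := Bⁿ ∩ ⋂_{j=1}^N { z ∈ ℝⁿ : z·e_j ≤ cos h }. Then P is a convex body and d_H(P, Bⁿ) ≤ 1 − cos h ≤ h². -/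
open MeasureTheory Metric Set Real Pointwise RealInnerProductSpace

noncomputable section

/-- Cutting off caps of geodesic radius `h` from the unit ball yields a convex body
within Hausdorff distance `1 - cos h ≤ h²` of the ball. -/
theorem hausdorffDist_capped_ball (n : ℕ) (hn : 1 ≤ n) (h : ℝ)
    (hh1 : 0 < h) (hh2 : h < π / 2) (N : ℕ) (e : Fin N → En n)
    (he : ∀ j, ‖e j‖ = 1) :
    IsConvexBody
        (Metric.closedBall (0 : En n) 1 ∩ ⋂ j, {z : En n | ⟪z, e j⟫ ≤ Real.cos h}) ∧
      Metric.hausdorffDist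
          (Metric.closedBall (0 : En n) 1 ∩ ⋂ j, {z : En n | ⟪z, e j⟫ ≤ Real.cos h})
          (Metric.closedBall (0 : En n) 1) ≤ 1 - Real.cos h ∧
      1 - Real.cos h ≤ h ^ 2 := by
  have hc0 : 0 < Real.cos h := Real.cos_pos_of_mem_Ioo ⟨by linarith, hh2⟩
  have hc1 : Real.cos h ≤ 1 := Real.cos_le_one h
  refine ⟨⟨⟨0, ?_⟩, ?_, ?_⟩, ?_, ?_⟩
  · simp [hc0.le]
  · apply (isCompact_closedBall (0 : En n) 1).inter_right
    apply isClosed_iInter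
    intro j
    exact isClosed_le (by fun_prop) continuous_const
  · apply (convex_closedBall (0 : En n) 1).inter
    apply convex_iInter
    intro j
    intro x hx y hy a b ha hb hab
    simp only [mem_setOf_eq] at hx hy ⊢
    rw [inner_add_left, real_inner_smul_left, real_inner_smul_left]
    have hb' : b = 1 - a := by linarith
    subst hb'
    nlinarith [mul_le_mul_of_nonneg_left hx ha, mul_le_mul_of_nonneg_left hy hb]
  · apply Metric.hausdorffDist_le_of_mem_dist (by linarith)
    · intro x hx
      exact ⟨x, hx.1, by simp [hc1]⟩
    · intro x hx
      have hx1 : ‖x‖ ≤ 1 := by simpa using hx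
      refine ⟨Real.cos h • x, ⟨?_, ?_⟩, ?_⟩
      · rw [mem_closedBall_zero_iff, norm_smul, Real.norm_of_nonneg hc0.le]
        nlinarith [norm_nonneg x]
      · rw [mem_iInter]
        intro j
        simp only [mem_setOf_eq]
        rw [real_inner_smul_left]
        have h1 := real_inner_le_norm x (e j)
        rw [he j] at h1
        nlinarith
      · rw [dist_eq_norm]
        have h2 : x - Real.cos h • x = (1 - Real.cos h) • x := by rw [sub_smul, one_smul]
        rw [h2, norm_smul, Real.norm_of_nonneg (by linarith)]
        nlinarith [norm_nonneg x]
  · nlinarith [Real.one_sub_sq_div_two_le_cos (x := h), sq_nonneg h]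

end
end

section
/- For every integer k ≥ 1 and every h ∈ (0, π/2), one has h^k / k − ((k−1)/(6(k+2))) · h^{k+2} ≤ ∫_0^h (sin t)^{k−1} dt ≤ h^k / k. -/
open Real

theorem sin_pow_lower_aux (n : ℕ) (t : ℝ) (h0 : 0 ≤ t) (hs : 0 ≤ Real.sin t) :
    t ^ n - (n : ℝ) / 6 * t ^ (n + 2) ≤ Real.sin t ^ n := by
  induction n with
  | zero => simp
  | succ n ih =>
    have h1 := Real.sin_le h0
    have h2 : t - t ^ 3 / 6 ≤ Real.sin t := Real.sin_ge_sub_cube h0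
    have h3 : Real.sin t ^ n ≤ t ^ n := pow_le_pow_left₀ hs h1 n
    have h4 := mul_le_mul_of_nonneg_left ih h0
    have h5 : Real.sin t ^ n * (t - Real.sin t) ≤ t ^ n * (t ^ 3 / 6) :=
      mul_le_mul h3 (by linarith) (by linarith) (by positivity)
    push_cast
    ring_nf at *
    linarith

/-- For every integer `k ≥ 1` and `h ∈ (0, π/2)`:
`h^k/k - ((k-1)/(6(k+2))) h^{k+2} ≤ ∫_0^h (sin t)^{k-1} dt ≤ h^k/k`. -/
theorem integral_sin_pow_bounds (k : ℕ) (hk : 1 ≤ k) (h : ℝ)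
    (hh1 : 0 < h) (hh2 : h < π / 2) :
    h ^ k / k - ((k : ℝ) - 1) / (6 * ((k : ℝ) + 2)) * h ^ (k + 2) ≤
        (∫ t in (0 : ℝ)..h, Real.sin t ^ (k - 1)) ∧
      (∫ t in (0 : ℝ)..h, Real.sin t ^ (k - 1)) ≤ h ^ k / k := by
  obtain ⟨n, rfl⟩ : ∃ n, k = n + 1 := ⟨k - 1, by omega⟩
  rw [Nat.add_sub_cancel]
  have hs : ∀ t ∈ Set.Icc 0 h, 0 ≤ Real.sin t := fun t ht =>
    Real.sin_nonneg_of_nonneg_of_le_pi ht.1 (by linarith [ht.2, Real.pi_pos])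
  have i1 : IntervalIntegrable (fun t : ℝ => Real.sin t ^ n) MeasureTheory.volume 0 h :=
    Continuous.intervalIntegrable (by fun_prop) _ _
  have i2 : IntervalIntegrable (fun t : ℝ => t ^ n) MeasureTheory.volume 0 h :=
    Continuous.intervalIntegrable (by fun_prop) _ _
  have i3 : IntervalIntegrable (fun t : ℝ => (n : ℝ) / 6 * t ^ (n + 2))
      MeasureTheory.volume 0 h :=
    Continuous.intervalIntegrable (by fun_prop) _ _
  have e : ∫ t in (0 : ℝ)..h, t ^ n = h ^ (n + 1) / ((n + 1 : ℕ) : ℝ) := by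
    rw [integral_pow]; simp
  constructor
  · have := intervalIntegral.integral_mono_on hh1.le (i2.sub i3) i1
      (fun t ht => sin_pow_lower_aux n t ht.1 (hs t ht))
    rw [intervalIntegral.integral_sub i2 i3, e, intervalIntegral.integral_const_mul,
      integral_pow] at this
    refine le_trans (le_of_eq ?_) this
    push_cast
    have : (n : ℝ) + 3 ≠ 0 := by positivity
    have : (n : ℝ) + 1 + 2 ≠ 0 := by positivity
    have : (n : ℝ) + 2 + 1 ≠ 0 := by positivity
    rw [zero_pow (by omega), sub_zero]
    congr 1
    field_simp
    ring
  · rw [← e]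
    exact intervalIntegral.integral_mono_on hh1.le i1 i2
      (fun t ht => pow_le_pow_left₀ (hs t ht) (Real.sin_le ht.1) n)
end
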